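/- arXiv:2301.01035 — 11 statements merged into one kernel-verified Lean document; each statement's English description precedes it below -/
import Mathlib

section
/- Let X be a locally compact metric space, D a linear subspace of C_c(X), and q a positive symmetric bilinear form on D. Let K ⊆ X be compact and let θ ∈ D satisfy θ ≥ 0 pointwise and θ ≥ 1 on K. Then for all f, g ∈ D with f ≥ 0, g ≥ 0 and supp f ⊆ K, supp g ⊆ K, one has 0 ≤ q(f,g) ≤ ‖f‖_∞ · ‖g‖_∞ · q(θ,θ). -/
/-- A compactly supported continuous function whose support lies in `K` is dominated by its
supremum norm times any nonnegative function that is at least `1` on `K`. -/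
lemma le_iSup_abs_mul_of_tsupport_subset {X : Type*} [TopologicalSpace X] {f θ : X → ℝ}
    {K : Set X} (hf : Continuous f) (hfc : HasCompactSupport f) (hfK : tsupport f ⊆ K)
    (hθ0 : ∀ x, 0 ≤ θ x) (hθ1 : ∀ x ∈ K, 1 ≤ θ x) (x : X) :
    f x ≤ (⨆ y, |f y|) * θ x := by
  have hsup : 0 ≤ ⨆ y, |f y| := Real.iSup_nonneg fun y => abs_nonneg (f y)
  by_cases hx : x ∈ K
  · obtain ⟨C, hC⟩ := hfc.exists_bound_of_continuous hf
    have hbdd : BddAbove (Set.range fun y => |f y|) :=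
      ⟨C, Set.forall_mem_range.2 hC⟩
    calc f x ≤ |f x| := le_abs_self _
      _ ≤ ⨆ y, |f y| := le_ciSup hbdd x
      _ ≤ (⨆ y, |f y|) * θ x := le_mul_of_one_le_right hsup (hθ1 x hx)
  · rw [image_eq_zero_of_notMem_tsupport fun h => hx (hfK h)]
    exact mul_nonneg hsup (hθ0 x)

/-- Let X be a locally compact metric space, D a linear subspace of
C_c(X), and q a positive symmetric bilinear form on D. Let K ⊆ X be compact and
θ ∈ D with θ ≥ 0 and θ ≥ 1 on K. Then for all nonnegative f, g ∈ D supported in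
K, one has 0 ≤ q(f,g) ≤ ‖f‖_∞ ‖g‖_∞ q(θ,θ). -/
theorem positive_form_bound_on_compact
    {X : Type*} [MetricSpace X] [LocallyCompactSpace X]
    (D : Set (X → ℝ))
    (hD_cc : ∀ f ∈ D, Continuous f ∧ HasCompactSupport f)
    (hD_zero : (0 : X → ℝ) ∈ D)
    (hD_add : ∀ f ∈ D, ∀ g ∈ D, f + g ∈ D)
    (hD_smul : ∀ (c : ℝ), ∀ f ∈ D, c • f ∈ D)
    (q : (X → ℝ) → (X → ℝ) → ℝ)
    (hq_symm : ∀ f ∈ D, ∀ g ∈ D, q f g = q g f)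
    (hq_add : ∀ f ∈ D, ∀ g ∈ D, ∀ h ∈ D, q (f + g) h = q f h + q g h)
    (hq_smul : ∀ (c : ℝ), ∀ f ∈ D, ∀ g ∈ D, q (c • f) g = c * q f g)
    (hq_pos : ∀ f ∈ D, ∀ g ∈ D, (∀ x, 0 ≤ f x) → (∀ x, 0 ≤ g x) → 0 ≤ q f g)
    (K : Set X) (hK : IsCompact K)
    (θ : X → ℝ) (hθD : θ ∈ D) (hθ0 : ∀ x, 0 ≤ θ x) (hθ1 : ∀ x ∈ K, 1 ≤ θ x)
    (f g : X → ℝ) (hfD : f ∈ D) (hgD : g ∈ D)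
    (hf0 : ∀ x, 0 ≤ f x) (hg0 : ∀ x, 0 ≤ g x)
    (hfK : tsupport f ⊆ K) (hgK : tsupport g ⊆ K) :
    0 ≤ q f g ∧ q f g ≤ (⨆ x, |f x|) * (⨆ x, |g x|) * q θ θ := by
  have key : ∀ u ∈ D, tsupport u ⊆ K → ∀ v ∈ D, (∀ x, 0 ≤ v x) →
      q u v ≤ (⨆ x, |u x|) * q θ v := by
    intro u hu huK v hv hv0
    have hdom := le_iSup_abs_mul_of_tsupport_subset (hD_cc u hu).1 (hD_cc u hu).2 huK hθ0 hθ1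
    have hpos := hq_pos _ (hD_add _ (hD_smul (⨆ x, |u x|) θ hθD) _ (hD_smul (-1) u hu)) v hv
      (fun x => by simpa using hdom x) hv0
    rw [hq_add _ (hD_smul _ θ hθD) _ (hD_smul _ u hu) v hv, hq_smul _ θ hθD v hv,
      hq_smul _ u hu v hv] at hpos
    linarith
  refine ⟨hq_pos f hfD g hgD hf0 hg0, ?_⟩
  calc q f g ≤ (⨆ x, |f x|) * q θ g := key f hfD hfK g hgD hg0
    _ = (⨆ x, |f x|) * q g θ := by rw [hq_symm θ hθD g hgD]
    _ ≤ (⨆ x, |f x|) * ((⨆ x, |g x|) * q θ θ) :=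
        mul_le_mul_of_nonneg_left (key g hgD hgK θ hθD hθ0)
          (Real.iSup_nonneg fun x => abs_nonneg (f x))
    _ = (⨆ x, |f x|) * (⨆ x, |g x|) * q θ θ := (mul_assoc _ _ _).symm
end

section
/- Let X be a locally compact metric space, D a linear sublattice of C_c(X) that is dense in C_c(X) with respect to the supremum norm, and q a positive symmetric bilinear form on D. Then for every compact set K ⊆ X there exists a constant C ≥ 0 such that |q(f,g)| ≤ C · ‖f‖_∞ · ‖g‖_∞ for all f, g ∈ D with supp f ⊆ K and supp g ⊆ K. -/
/-- Let X be a locally compact metric space, D a dense linear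
sublattice of C_c(X), and q a positive symmetric bilinear form on D. Then for
every compact K ⊆ X there is C ≥ 0 with |q(f,g)| ≤ C ‖f‖_∞ ‖g‖_∞ for all
f, g ∈ D supported in K. -/
theorem positive_form_continuous_on_compact
    {X : Type*} [MetricSpace X] [LocallyCompactSpace X]
    (D : Set (X → ℝ))
    (hD_cc : ∀ f ∈ D, Continuous f ∧ HasCompactSupport f)
    (hD_zero : (0 : X → ℝ) ∈ D)
    (hD_add : ∀ f ∈ D, ∀ g ∈ D, f + g ∈ D)
    (hD_smul : ∀ (c : ℝ), ∀ f ∈ D, c • f ∈ D)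
    (hD_abs : ∀ f ∈ D, (fun x => |f x|) ∈ D)
    (hD_dense : ∀ g : X → ℝ, Continuous g → HasCompactSupport g →
      ∀ ε > 0, ∃ f ∈ D, ∀ x, |f x - g x| < ε)
    (q : (X → ℝ) → (X → ℝ) → ℝ)
    (hq_symm : ∀ f ∈ D, ∀ g ∈ D, q f g = q g f)
    (hq_add : ∀ f ∈ D, ∀ g ∈ D, ∀ h ∈ D, q (f + g) h = q f h + q g h)
    (hq_smul : ∀ (c : ℝ), ∀ f ∈ D, ∀ g ∈ D, q (c • f) g = c * q f g)
    (hq_pos : ∀ f ∈ D, ∀ g ∈ D, (∀ x, 0 ≤ f x) → (∀ x, 0 ≤ g x) → 0 ≤ q f g)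
    (K : Set X) (hK : IsCompact K) :
    ∃ C : ℝ, 0 ≤ C ∧ ∀ f ∈ D, ∀ g ∈ D, tsupport f ⊆ K → tsupport g ⊆ K →
      |q f g| ≤ C * (⨆ x, |f x|) * (⨆ x, |g x|) := by
  obtain ⟨φ, hφ1, -, hφc, -⟩ :=
    exists_continuous_one_zero_of_isCompact hK isClosed_empty (Set.disjoint_empty K)
  obtain ⟨p, hpD, hp⟩ := hD_dense φ φ.continuous hφc (1 / 2) (by norm_num)
  obtain ⟨χ, hχD, hχ0, hχ1⟩ : ∃ χ ∈ D, (∀ x, 0 ≤ χ x) ∧ ∀ x ∈ K, 1 ≤ χ x := by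
    refine ⟨(2 : ℝ) • (fun x => |p x|), hD_smul _ _ (hD_abs p hpD), fun x => ?_, fun x hx => ?_⟩
    · simp
    · have h1 : φ x = 1 := hφ1 hx
      have h2 := abs_lt.mp (hp x)
      have h3 := le_abs_self (p x)
      simp only [Pi.smul_apply, smul_eq_mul]
      linarith
  have q_add_right : ∀ f ∈ D, ∀ g ∈ D, ∀ h ∈ D, q f (g + h) = q f g + q f h := by
    intro f hf g hg h hh
    rw [hq_symm f hf _ (hD_add g hg h hh), hq_add g hg h hh f hf, hq_symm g hg f hf,
      hq_symm h hh f hf]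
  have q_smul_right : ∀ (c : ℝ), ∀ f ∈ D, ∀ g ∈ D, q f (c • g) = c * q f g := by
    intro c f hf g hg
    rw [hq_symm f hf _ (hD_smul c g hg), hq_smul c g hg f hf, hq_symm g hg f hf]
  have abs_le_smul : ∀ f ∈ D, tsupport f ⊆ K → ∀ x, |f x| ≤ (⨆ y, |f y|) * χ x := by
    intro f hf hfK x
    have hsup : 0 ≤ ⨆ y, |f y| := Real.iSup_nonneg fun y => abs_nonneg _
    by_cases hx : x ∈ K
    · obtain ⟨hc, hs⟩ := hD_cc f hf
      obtain ⟨M, hM⟩ := hs.exists_bound_of_continuous hc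
      have hbdd : BddAbove (Set.range fun y => |f y|) := by
        refine ⟨M, ?_⟩
        rintro _ ⟨y, rfl⟩
        exact hM y
      exact (le_ciSup hbdd x).trans (le_mul_of_one_le_right hsup (hχ1 x hx))
    · rw [image_eq_zero_of_notMem_tsupport fun h => hx (hfK h), abs_zero]
      exact mul_nonneg hsup (hχ0 x)
  refine ⟨q χ χ, hq_pos χ hχD χ hχD hχ0 hχ0, fun f hf g hg hfK hgK => ?_⟩
  set a := ⨆ x, |f x|
  set b := ⨆ x, |g x|
  have key : ∀ s t : ℝ, |s| = 1 → |t| = 1 →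
      0 ≤ a * b * q χ χ + a * t * q χ g + s * b * q f χ + s * t * q f g := by
    intro s t hs ht
    have hu := hD_smul a χ hχD
    have hv := hD_smul b χ hχD
    have hsf := hD_smul s f hf
    have htg := hD_smul t g hg
    have hpos := hq_pos _ (hD_add _ hu _ hsf) _ (hD_add _ hv _ htg)
      (fun x => by
        have h1 := abs_le_smul f hf hfK x
        have h2 := neg_abs_le (s * f x)
        rw [abs_mul, hs, one_mul] at h2
        simp only [Pi.add_apply, Pi.smul_apply, smul_eq_mul]
        linarith)
      (fun x => by
        have h1 := abs_le_smul g hg hgK x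
        have h2 := neg_abs_le (t * g x)
        rw [abs_mul, ht, one_mul] at h2
        simp only [Pi.add_apply, Pi.smul_apply, smul_eq_mul]
        linarith)
    rw [hq_add _ hu _ hsf _ (hD_add _ hv _ htg), q_add_right _ hu _ hv _ htg,
      q_add_right _ hsf _ hv _ htg, hq_smul a χ hχD _ hv, hq_smul a χ hχD _ htg,
      hq_smul s f hf _ hv, hq_smul s f hf _ htg, q_smul_right b χ hχD χ hχD,
      q_smul_right t χ hχD g hg, q_smul_right b f hf χ hχD, q_smul_right t f hf g hg] at hpos
    linarith
  have h1 := key 1 1 (by simp) (by simp)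
  have h2 := key (-1) (-1) (by simp) (by simp)
  have h3 := key 1 (-1) (by simp) (by simp)
  have h4 := key (-1) 1 (by simp) (by simp)
  rw [abs_le]
  constructor <;> linarith
end

section
/- Let X be a locally compact metric space and let D be a linear sublattice of C_c(X) that is dense in C_c(X) with respect to the supremum norm. Then for every nonnegative φ ∈ C_c(X) there exist a compact set K ⊆ X with supp φ ⊆ K and a sequence (φ_n) of nonnegative functions in D with supp φ_n ⊆ K for all n, such that ‖φ_n − φ‖_∞ → 0 as n → ∞. -/
/-- A set of real functions closed under addition, scalar multiplication and absolute value is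
closed under pointwise minimum. -/
theorem min_mem_of_abs_mem {X : Type*} {D : Set (X → ℝ)}
    (hadd : ∀ f ∈ D, ∀ g ∈ D, f + g ∈ D)
    (hsmul : ∀ (c : ℝ), ∀ f ∈ D, c • f ∈ D)
    (habs : ∀ f ∈ D, (fun x => |f x|) ∈ D)
    {f g : X → ℝ} (hf : f ∈ D) (hg : g ∈ D) : (fun x => min (f x) (g x)) ∈ D := by
  have hdiff := habs _ (hadd _ hf _ (hsmul (-1) _ hg))
  convert hsmul (1 / 2) _ (hadd _ (hadd _ hf _ hg) _ (hsmul (-1) _ hdiff)) using 1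
  funext x
  simp only [Pi.smul_apply, Pi.add_apply, smul_eq_mul]
  rw [show f x + -1 * g x = f x - g x by ring]
  rcases le_total (f x) (g x) with h | h
  · rw [min_eq_left h, abs_of_nonpos (by linarith)]
    ring
  · rw [min_eq_right h, abs_of_nonneg (by linarith)]
    ring


/-- Let X be a locally compact metric space and D a dense linear
sublattice of C_c(X). Then every nonnegative φ ∈ C_c(X) can be uniformly
approximated by nonnegative functions of D whose supports are contained in a
fixed compact set K ⊇ supp φ. -/
theorem dense_sublattice_nonneg_approx
    {X : Type*} [MetricSpace X] [LocallyCompactSpace X]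
    (D : Set (X → ℝ))
    (hD_cc : ∀ f ∈ D, Continuous f ∧ HasCompactSupport f)
    (hD_zero : (0 : X → ℝ) ∈ D)
    (hD_add : ∀ f ∈ D, ∀ g ∈ D, f + g ∈ D)
    (hD_smul : ∀ (c : ℝ), ∀ f ∈ D, c • f ∈ D)
    (hD_abs : ∀ f ∈ D, (fun x => |f x|) ∈ D)
    (hD_dense : ∀ g : X → ℝ, Continuous g → HasCompactSupport g →
      ∀ ε > 0, ∃ f ∈ D, ∀ x, |f x - g x| < ε)
    (φ : X → ℝ) (hφc : Continuous φ) (hφs : HasCompactSupport φ)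
    (hφ0 : ∀ x, 0 ≤ φ x) :
    ∃ (K : Set X) (φn : ℕ → X → ℝ), IsCompact K ∧ tsupport φ ⊆ K ∧
      (∀ n, φn n ∈ D ∧ (∀ x, 0 ≤ φn n x) ∧ tsupport (φn n) ⊆ K) ∧
      Filter.Tendsto (fun n => ⨆ x, |φn n x - φ x|) Filter.atTop (nhds 0) := by
  obtain ⟨M, hM⟩ := hφc.bounded_above_of_compact_support hφs
  obtain ⟨u, hu1, -, hu_supp, -⟩ := exists_continuous_one_zero_of_isCompact
    (s := tsupport φ) (t := ∅) hφs isClosed_empty (Set.disjoint_empty _)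
  obtain ⟨f, hfD, hf⟩ := hD_dense (fun x => (M + 2) * u x) (by fun_prop)
    hu_supp.mul_left 1 one_pos
  have hf_large : ∀ x ∈ tsupport φ, M + 1 < |f x| := by
    intro x hx
    have h1 := abs_lt.mp (hf x)
    have h2 : u x = 1 := hu1 hx
    rw [h2] at h1
    exact lt_of_lt_of_le (by linarith) (le_abs_self _)
  have hM0 : ∀ x, 0 ≤ M := fun x => (norm_nonneg _).trans (hM x)
  have hε : ∀ n : ℕ, (0 : ℝ) < 1 / ((n : ℝ) + 1) := fun n => Nat.one_div_pos_of_nat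
  choose g hgD hg using fun n : ℕ => hD_dense φ hφc hφs _ (hε n)
  refine ⟨tsupport f, fun n x => min |g n x| |f x|, (hD_cc f hfD).2, ?_, fun n => ⟨?_, ?_, ?_⟩, ?_⟩
  · intro x hx
    refine subset_tsupport f fun h0 => ?_
    have h1 := hf_large x hx
    rw [h0, abs_zero] at h1
    linarith [hM0 x]
  · exact min_mem_of_abs_mem hD_add hD_smul hD_abs (hD_abs _ (hgD n)) (hD_abs _ hfD)
  · exact fun x => le_min (abs_nonneg _) (abs_nonneg _)
  · refine closure_mono fun x hx h0 => hx ?_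
    simp [h0]
  · refine squeeze_zero (fun n => Real.iSup_nonneg fun x => abs_nonneg _)
      (fun n => Real.iSup_le (fun x => ?_) (hε n).le) tendsto_one_div_add_atTop_nhds_zero_nat
    change |min |g n x| |f x| - φ x| ≤ 1 / ((n : ℝ) + 1)
    have hgx : |(|g n x| - φ x)| < 1 / ((n : ℝ) + 1) := by
      have := abs_abs_sub_abs_le_abs_sub (g n x) (φ x)
      rw [abs_of_nonneg (hφ0 x)] at this
      exact this.trans_lt (hg n x)
    by_cases hx : x ∈ tsupport φ
    · have h1 : 1 / ((n : ℝ) + 1) ≤ 1 := by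
        rw [div_le_one (by positivity)]
        linarith [n.cast_nonneg (α := ℝ)]
      have h2 := (le_abs_self _).trans (hM x)
      rw [min_eq_left (by linarith [(abs_lt.mp hgx).2, hf_large x hx])]
      exact hgx.le
    · rw [image_eq_zero_of_notMem_tsupport hx, sub_zero] at hgx ⊢
      rw [abs_abs] at hgx
      rw [abs_of_nonneg (le_min (abs_nonneg _) (abs_nonneg _))]
      exact (min_le_left _ _).trans hgx.le
end

section
/- Let X be a locally compact metric space, D a linear sublattice of C_c(X) that is dense in C_c(X) with respect to the supremum norm, and q a positive symmetric bilinear form on D. Then there exists a unique positive symmetric bilinear form q̄ on all of C_c(X) such that q̄(f,g) = q(f,g) for all f, g ∈ D. -/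
/-- The set of real-valued continuous compactly supported functions on `X`. -/
def Cc (X : Type*) [TopologicalSpace X] : Set (X → ℝ) :=
  {f | Continuous f ∧ HasCompactSupport f}

open Filter Topology

/-- `D` is a linear sublattice of the real functions on `X` and `q` is a positive symmetric
bilinear form on `D`. -/
structure IsPositiveForm {X : Type*} (D : Set (X → ℝ)) (q : (X → ℝ) → (X → ℝ) → ℝ) : Prop where
  add_mem : ∀ f ∈ D, ∀ g ∈ D, f + g ∈ D
  smul_mem : ∀ (c : ℝ), ∀ f ∈ D, c • f ∈ D
  abs_mem : ∀ f ∈ D, (fun x => |f x|) ∈ D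
  symm : ∀ f ∈ D, ∀ g ∈ D, q f g = q g f
  add_left : ∀ f ∈ D, ∀ g ∈ D, ∀ h ∈ D, q (f + g) h = q f h + q g h
  smul_left : ∀ (c : ℝ), ∀ f ∈ D, ∀ g ∈ D, q (c • f) g = c * q f g
  nonneg : ∀ f ∈ D, ∀ g ∈ D, (∀ x, 0 ≤ f x) → (∀ x, 0 ≤ g x) → 0 ≤ q f g

namespace IsPositiveForm

variable {X : Type*} {D : Set (X → ℝ)} {q : (X → ℝ) → (X → ℝ) → ℝ}

lemma sub_mem (h : IsPositiveForm D q) {f g : X → ℝ} (hf : f ∈ D) (hg : g ∈ D) : f - g ∈ D := by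
  have := h.add_mem f hf _ (h.smul_mem (-1) g hg)
  rwa [neg_one_smul, ← sub_eq_add_neg] at this

lemma sub_left (h : IsPositiveForm D q) {f g k : X → ℝ} (hf : f ∈ D) (hg : g ∈ D) (hk : k ∈ D) :
    q (f - g) k = q f k - q g k := by
  have := h.add_left (f - g) (h.sub_mem hf hg) g hg k hk
  rw [sub_add_cancel] at this
  linarith

lemma add_right (h : IsPositiveForm D q) {f g k : X → ℝ} (hf : f ∈ D) (hg : g ∈ D) (hk : k ∈ D) :
    q k (f + g) = q k f + q k g := by
  rw [h.symm _ hk _ (h.add_mem _ hf _ hg), h.add_left _ hf _ hg _ hk, h.symm _ hf _ hk,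
    h.symm _ hg _ hk]

lemma sub_right (h : IsPositiveForm D q) {f g k : X → ℝ} (hf : f ∈ D) (hg : g ∈ D) (hk : k ∈ D) :
    q k (f - g) = q k f - q k g := by
  rw [h.symm _ hk _ (h.sub_mem hf hg), h.sub_left hf hg hk, h.symm _ hf _ hk, h.symm _ hg _ hk]

lemma smul_right (h : IsPositiveForm D q) (c : ℝ) {f g : X → ℝ} (hf : f ∈ D) (hg : g ∈ D) :
    q f (c • g) = c * q f g := by
  rw [h.symm _ hf _ (h.smul_mem c g hg), h.smul_left c _ hg _ hf, h.symm _ hg _ hf]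

lemma abs_le (h : IsPositiveForm D q) {f g u v : X → ℝ} (hf : f ∈ D) (hg : g ∈ D) (hu : u ∈ D)
    (hv : v ∈ D) (hfu : ∀ x, |f x| ≤ u x) (hgv : ∀ x, |g x| ≤ v x) : |q f g| ≤ q u v := by
  have hf₁ : ∀ x, 0 ≤ (u + f) x := fun x => by
    have := neg_abs_le (f x); have := hfu x; simp only [Pi.add_apply]; linarith
  have hf₂ : ∀ x, 0 ≤ (u - f) x := fun x => by
    have := le_abs_self (f x); have := hfu x; simp only [Pi.sub_apply]; linarith
  have hg₁ : ∀ x, 0 ≤ (v + g) x := fun x => by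
    have := neg_abs_le (g x); have := hgv x; simp only [Pi.add_apply]; linarith
  have hg₂ : ∀ x, 0 ≤ (v - g) x := fun x => by
    have := le_abs_self (g x); have := hgv x; simp only [Pi.sub_apply]; linarith
  have a := h.add_mem _ hu _ hf
  have b := h.sub_mem hu hf
  have c := h.add_mem _ hv _ hg
  have d := h.sub_mem hv hg
  have h₁ := h.nonneg _ a _ c hf₁ hg₁
  have h₂ := h.nonneg _ a _ d hf₁ hg₂
  have h₃ := h.nonneg _ b _ c hf₂ hg₁
  have h₄ := h.nonneg _ b _ d hf₂ hg₂
  rw [h.add_left _ hu _ hf _ c, h.add_right hv hg hu, h.add_right hv hg hf] at h₁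
  rw [h.add_left _ hu _ hf _ d, h.sub_right hv hg hu, h.sub_right hv hg hf] at h₂
  rw [h.sub_left hu hf c, h.add_right hv hg hu, h.add_right hv hg hf] at h₃
  rw [h.sub_left hu hf d, h.sub_right hv hg hu, h.sub_right hv hg hf] at h₄
  rw [_root_.abs_le]
  constructor <;> linarith

end IsPositiveForm

/-- The sequence `a` in `D` converges to `f` at rate `1 / (n + 1)` relative to some `e ∈ D` which
also dominates `f`. -/
def ConvergesRelatively {X : Type*} (D : Set (X → ℝ)) (a : ℕ → X → ℝ) (f : X → ℝ) : Prop :=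
  ∃ e ∈ D, (∀ x, |f x| ≤ e x) ∧
    ∀ n, a n ∈ D ∧ ∀ x, |a n x - f x| ≤ 1 / ((n : ℝ) + 1) * e x

namespace ConvergesRelatively

variable {X : Type*} {D E : Set (X → ℝ)} {q : (X → ℝ) → (X → ℝ) → ℝ} {a a' b b' : ℕ → X → ℝ}
  {f g : X → ℝ}

lemma mem (ha : ConvergesRelatively D a f) (n : ℕ) : a n ∈ D := by
  obtain ⟨e, -, -, h⟩ := ha
  exact (h n).1

lemma mono (hDE : D ⊆ E) (ha : ConvergesRelatively D a f) : ConvergesRelatively E a f := by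
  obtain ⟨e, he, hf, h⟩ := ha
  exact ⟨e, hDE he, hf, fun n => ⟨hDE (h n).1, (h n).2⟩⟩

lemma const (h : IsPositiveForm D q) (hf : f ∈ D) : ConvergesRelatively D (fun _ => f) f :=
  ⟨_, h.abs_mem f hf, fun _ => le_rfl, fun n => ⟨hf, fun x => by
    rw [sub_self, abs_zero]; positivity⟩⟩

lemma add (h : IsPositiveForm D q) (ha : ConvergesRelatively D a f)
    (hb : ConvergesRelatively D b g) : ConvergesRelatively D (fun n => a n + b n) (f + g) := by
  obtain ⟨e, he, hf, ha⟩ := ha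
  obtain ⟨k, hk, hg, hb⟩ := hb
  refine ⟨e + k, h.add_mem _ he _ hk, fun x => (abs_add_le _ _).trans (add_le_add (hf x) (hg x)),
    fun n => ⟨h.add_mem _ (ha n).1 _ (hb n).1, fun x => ?_⟩⟩
  have := abs_add_le (a n x - f x) (b n x - g x)
  have := (ha n).2 x
  have := (hb n).2 x
  simp only [Pi.add_apply, mul_add]
  rw [add_sub_add_comm]
  linarith

lemma smul (h : IsPositiveForm D q) (c : ℝ) (ha : ConvergesRelatively D a f) :
    ConvergesRelatively D (fun n => c • a n) (c • f) := by
  obtain ⟨e, he, hf, ha⟩ := ha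
  refine ⟨|c| • e, h.smul_mem _ _ he, fun x => ?_, fun n => ⟨h.smul_mem _ _ (ha n).1, fun x => ?_⟩⟩
  · simp only [Pi.smul_apply, smul_eq_mul, abs_mul]
    exact mul_le_mul_of_nonneg_left (hf x) (abs_nonneg c)
  · simp only [Pi.smul_apply, smul_eq_mul, ← mul_sub, abs_mul, mul_left_comm _ |c|]
    exact mul_le_mul_of_nonneg_left ((ha n).2 x) (abs_nonneg c)

lemma abs (h : IsPositiveForm D q) (ha : ConvergesRelatively D a f) :
    ConvergesRelatively D (fun n x => |a n x|) (fun x => |f x|) := by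
  obtain ⟨e, he, hf, ha⟩ := ha
  exact ⟨e, he, fun x => by rw [abs_abs]; exact hf x, fun n => ⟨h.abs_mem _ (ha n).1,
    fun x => (abs_abs_sub_abs_le _ _).trans ((ha n).2 x)⟩⟩

lemma exists_bound (h : IsPositiveForm D q) (ha : ConvergesRelatively D a f)
    (ha' : ConvergesRelatively D a' f) :
    ∃ u ∈ D, ∀ n m x, |a n x| ≤ u x ∧ |a' n x| ≤ u x ∧
      |(a n - a' m) x| ≤ ((1 / ((n : ℝ) + 1) + 1 / ((m : ℝ) + 1)) • u) x := by
  obtain ⟨e, he, hf, ha⟩ := ha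
  obtain ⟨e', he', hf', ha'⟩ := ha'
  refine ⟨(2 : ℝ) • (e + e'), h.smul_mem _ _ (h.add_mem _ he _ he'), fun n m x => ?_⟩
  have hn := (ha n).2 x
  have hn' := (ha' n).2 x
  have hm' := (ha' m).2 x
  have hle (k : ℕ) : 1 / ((k : ℝ) + 1) ≤ 1 := by
    rw [div_le_one (by positivity)]; linarith [(Nat.cast_nonneg k : (0 : ℝ) ≤ k)]
  have hpos (k : ℕ) : 0 ≤ 1 / ((k : ℝ) + 1) := by positivity
  have he0 : 0 ≤ e x := (abs_nonneg _).trans (hf x)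
  have he0' : 0 ≤ e' x := (abs_nonneg _).trans (hf' x)
  have h₁ := mul_le_of_le_one_left he0 (hle n)
  have h₂ := mul_le_of_le_one_left he0' (hle n)
  have h₃ := mul_nonneg (hpos n) he0
  have h₄ := mul_nonneg (hpos n) he0'
  have h₅ := mul_nonneg (hpos m) he0
  have h₆ := mul_nonneg (hpos m) he0'
  have hfx := hf x
  have hfx' := hf' x
  simp only [Pi.smul_apply, Pi.add_apply, Pi.sub_apply, smul_eq_mul]
  refine ⟨?_, ?_, ?_⟩
  · have := abs_sub_abs_le_abs_sub (a n x) (f x)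
    linarith
  · have := abs_sub_abs_le_abs_sub (a' n x) (f x)
    linarith
  · have := abs_sub_le (a n x) (f x) (a' m x)
    rw [abs_sub_comm (f x)] at this
    linarith

lemma exists_abs_sub_le (h : IsPositiveForm D q) (ha : ConvergesRelatively D a f)
    (ha' : ConvergesRelatively D a' f) (hb : ConvergesRelatively D b g)
    (hb' : ConvergesRelatively D b' g) :
    ∃ C, ∀ n m : ℕ, |q (a n) (b n) - q (a' m) (b' m)| ≤
      (1 / ((n : ℝ) + 1) + 1 / ((m : ℝ) + 1)) * C := by
  obtain ⟨u, hu, hau⟩ := exists_bound h ha ha'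
  obtain ⟨v, hv, hbv⟩ := exists_bound h hb hb'
  refine ⟨q u v + q u v, fun n m => ?_⟩
  have haa := h.sub_mem (ha.mem n) (ha'.mem m)
  have hbb := h.sub_mem (hb.mem n) (hb'.mem m)
  have h₁ := h.abs_le haa (hb.mem n) (h.smul_mem _ _ hu) hv (fun x => (hau n m x).2.2)
    (fun x => (hbv n m x).1)
  have h₂ := h.abs_le (ha'.mem m) hbb hu (h.smul_mem _ _ hv) (fun x => (hau m m x).2.1)
    (fun x => (hbv n m x).2.2)
  rw [h.smul_left _ _ hu _ hv, h.sub_left (ha.mem n) (ha'.mem m) (hb.mem n)] at h₁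
  rw [h.smul_right _ hu hv, h.sub_right (hb.mem n) (hb'.mem m) (ha'.mem m)] at h₂
  have := abs_sub_le (q (a n) (b n)) (q (a' m) (b n)) (q (a' m) (b' m))
  linarith

lemma tendsto_of_tendsto (h : IsPositiveForm D q) (ha : ConvergesRelatively D a f)
    (ha' : ConvergesRelatively D a' f) (hb : ConvergesRelatively D b g)
    (hb' : ConvergesRelatively D b' g) {c : ℝ}
    (hc : Tendsto (fun n => q (a n) (b n)) atTop (𝓝 c)) :
    Tendsto (fun n => q (a' n) (b' n)) atTop (𝓝 c) := by
  obtain ⟨C, hC⟩ := exists_abs_sub_le h ha' ha hb' hb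
  have hlim := tendsto_one_div_add_atTop_nhds_zero_nat (𝕜 := ℝ)
  have h₀ : Tendsto (fun n => q (a' n) (b' n) - q (a n) (b n)) atTop (𝓝 0) := by
    refine squeeze_zero_norm (fun n => hC n n) ?_
    simpa using (hlim.add hlim).mul_const C
  simpa using h₀.add hc

lemma exists_tendsto (h : IsPositiveForm D q) (ha : ConvergesRelatively D a f)
    (hb : ConvergesRelatively D b g) : ∃ c, Tendsto (fun n => q (a n) (b n)) atTop (𝓝 c) := by
  obtain ⟨C, hC⟩ := exists_abs_sub_le h ha ha hb hb
  refine cauchySeq_tendsto_of_complete (cauchySeq_of_le_tendsto_0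
    (fun n : ℕ => (1 / ((n : ℝ) + 1) + 1 / ((n : ℝ) + 1)) * |C|) (fun n m N hn hm => ?_) ?_)
  · refine (hC n m).trans ?_
    have hN := add_le_add (Nat.one_div_le_one_div (α := ℝ) hn) (Nat.one_div_le_one_div (α := ℝ) hm)
    exact (mul_le_mul_of_nonneg_left (le_abs_self C) (by positivity)).trans
      (mul_le_mul_of_nonneg_right hN (abs_nonneg C))
  · have hlim := tendsto_one_div_add_atTop_nhds_zero_nat (𝕜 := ℝ)
    simpa using (hlim.add hlim).mul_const |C|

end ConvergesRelatively

lemma Cc.abs_mem {X : Type*} [TopologicalSpace X] {f : X → ℝ} (hf : f ∈ Cc X) :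
    (fun x => |f x|) ∈ Cc X :=
  ⟨hf.1.abs, hf.2.comp_left (g := fun t : ℝ => |t|) abs_zero⟩

section Dense

variable {X : Type*} [MetricSpace X] [LocallyCompactSpace X] {D : Set (X → ℝ)}

lemma exists_mem_one_le_on_compact (hD_abs : ∀ f ∈ D, (fun x => |f x|) ∈ D)
    (hD_dense : ∀ g ∈ Cc X, ∀ ε > 0, ∃ f ∈ D, ∀ x, |f x - g x| < ε) {K : Set X}
    (hK : IsCompact K) : ∃ e ∈ D, (∀ x, 0 ≤ e x) ∧ ∀ x ∈ K, 1 ≤ e x := by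
  obtain ⟨β, hβK, -, hβ, -⟩ := exists_continuous_one_zero_of_isCompact hK isClosed_empty
    (Set.disjoint_empty K)
  have h2β : (fun x => 2 * β x) ∈ Cc X := ⟨by fun_prop, hβ.mul_left (f := fun _ => (2 : ℝ))⟩
  obtain ⟨φ, hφ, h⟩ := hD_dense _ h2β 1 one_pos
  refine ⟨_, hD_abs φ hφ, fun x => abs_nonneg _, fun x hx => ?_⟩
  have hx' := h x
  rw [hβK hx, Pi.one_apply, abs_lt] at hx'
  have := le_abs_self (φ x)
  linarith

lemma exists_convergesRelatively {q : (X → ℝ) → (X → ℝ) → ℝ} (h : IsPositiveForm D q)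
    (hD_cc : D ⊆ Cc X)
    (hD_dense : ∀ g ∈ Cc X, ∀ ε > 0, ∃ f ∈ D, ∀ x, |f x - g x| < ε) {f : X → ℝ}
    (hf : f ∈ Cc X) : ∃ a, ConvergesRelatively D a f := by
  obtain ⟨M, hM⟩ := hf.2.exists_bound_of_continuous hf.1
  obtain ⟨e₁, he₁, h₁0, h₁⟩ := exists_mem_one_le_on_compact h.abs_mem hD_dense hf.2
  obtain ⟨e₂, he₂, h₂0, h₂⟩ := exists_mem_one_le_on_compact h.abs_mem hD_dense (hD_cc he₁).2
  have hfe (x : X) : |f x| ≤ (|M| • e₁) x := by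
    by_cases hx : f x = 0
    · rw [hx, abs_zero]
      exact mul_nonneg (abs_nonneg M) (h₁0 x)
    · have hx' := h₁ x (subset_tsupport f hx)
      have := hM x
      rw [Real.norm_eq_abs] at this
      exact (this.trans (le_abs_self M)).trans (le_mul_of_one_le_right (abs_nonneg M) hx')
  have hu := h.smul_mem |M| _ he₁
  generalize hudef : |M| • e₁ = u at hu hfe
  choose p hpD hp using fun n : ℕ => hD_dense f hf (1 / ((n : ℝ) + 1)) (by positivity)
  refine ⟨fun n => (1 / 2 : ℝ) • ((fun x => |(p n + u) x|) - fun x => |(p n - u) x|),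
    u + e₂, h.add_mem _ hu _ he₂, fun x => ?_, fun n => ⟨h.smul_mem _ _ (h.sub_mem
      (h.abs_mem _ (h.add_mem _ (hpD n) _ hu)) (h.abs_mem _ (h.sub_mem (hpD n) hu))), fun x => ?_⟩⟩
  · exact (hfe x).trans (le_add_of_nonneg_right (h₂0 x))
  · have hux := hfe x
    have hu0 : 0 ≤ u x := (abs_nonneg _).trans hux
    simp only [Pi.smul_apply, Pi.add_apply, Pi.sub_apply, smul_eq_mul]
    have hδ : 0 ≤ 1 / ((n : ℝ) + 1) := by positivity
    by_cases hx : e₁ x = 0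
    · have : u x = 0 := by rw [← hudef]; simp [hx]
      have hfx : f x = 0 := by rw [this] at hux; exact abs_nonpos_iff.1 hux
      simp only [this, hfx, add_zero, sub_zero, sub_self, mul_zero, abs_zero, zero_add]
      exact mul_nonneg hδ (h₂0 x)
    · have hx' := h₂ x (subset_tsupport e₁ hx)
      have hpx := (hp n x).le
      have hclamp : |1 / 2 * (|p n x + u x| - |p n x - u x|) - f x| ≤ |p n x - f x| := by
        grind
      exact (hclamp.trans hpx).trans (le_mul_of_one_le_right hδ (by linarith))

end Dense

/-- Let X be a locally compact metric space, D a dense linear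
sublattice of C_c(X) and q a positive symmetric bilinear form on D. Then q can
be uniquely extended to a positive symmetric bilinear form on all of C_c(X). -/
theorem positive_form_unique_extension
    {X : Type*} [MetricSpace X] [LocallyCompactSpace X]
    (D : Set (X → ℝ))
    (hD_cc : D ⊆ Cc X)
    (hD_zero : (0 : X → ℝ) ∈ D)
    (hD_add : ∀ f ∈ D, ∀ g ∈ D, f + g ∈ D)
    (hD_smul : ∀ (c : ℝ), ∀ f ∈ D, c • f ∈ D)
    (hD_abs : ∀ f ∈ D, (fun x => |f x|) ∈ D)
    (hD_dense : ∀ g ∈ Cc X, ∀ ε > 0, ∃ f ∈ D, ∀ x, |f x - g x| < ε)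
    (q : (X → ℝ) → (X → ℝ) → ℝ)
    (hq_symm : ∀ f ∈ D, ∀ g ∈ D, q f g = q g f)
    (hq_add : ∀ f ∈ D, ∀ g ∈ D, ∀ h ∈ D, q (f + g) h = q f h + q g h)
    (hq_smul : ∀ (c : ℝ), ∀ f ∈ D, ∀ g ∈ D, q (c • f) g = c * q f g)
    (hq_pos : ∀ f ∈ D, ∀ g ∈ D, (∀ x, 0 ≤ f x) → (∀ x, 0 ≤ g x) → 0 ≤ q f g) :
    ∃ Q : (X → ℝ) → (X → ℝ) → ℝ,
      ((∀ f ∈ Cc X, ∀ g ∈ Cc X, Q f g = Q g f) ∧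
       (∀ f ∈ Cc X, ∀ g ∈ Cc X, ∀ h ∈ Cc X, Q (f + g) h = Q f h + Q g h) ∧
       (∀ (c : ℝ), ∀ f ∈ Cc X, ∀ g ∈ Cc X, Q (c • f) g = c * Q f g) ∧
       (∀ f ∈ Cc X, ∀ g ∈ Cc X, (∀ x, 0 ≤ f x) → (∀ x, 0 ≤ g x) → 0 ≤ Q f g) ∧
       (∀ f ∈ D, ∀ g ∈ D, Q f g = q f g)) ∧
      ∀ Q' : (X → ℝ) → (X → ℝ) → ℝ,
        ((∀ f ∈ Cc X, ∀ g ∈ Cc X, Q' f g = Q' g f) ∧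
         (∀ f ∈ Cc X, ∀ g ∈ Cc X, ∀ h ∈ Cc X, Q' (f + g) h = Q' f h + Q' g h) ∧
         (∀ (c : ℝ), ∀ f ∈ Cc X, ∀ g ∈ Cc X, Q' (c • f) g = c * Q' f g) ∧
         (∀ f ∈ Cc X, ∀ g ∈ Cc X, (∀ x, 0 ≤ f x) → (∀ x, 0 ≤ g x) → 0 ≤ Q' f g) ∧
         (∀ f ∈ D, ∀ g ∈ D, Q' f g = q f g)) →
        ∀ f ∈ Cc X, ∀ g ∈ Cc X, Q' f g = Q f g := by
  have h : IsPositiveForm D q :=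
    ⟨hD_add, hD_smul, hD_abs, hq_symm, hq_add, hq_smul, hq_pos⟩
  have key : ∀ f g : X → ℝ, ∃ c, ∀ a b, ConvergesRelatively D a f →
      ConvergesRelatively D b g → Tendsto (fun n => q (a n) (b n)) atTop (𝓝 c) := by
    intro f g
    by_cases hfg : (∃ a, ConvergesRelatively D a f) ∧ ∃ b, ConvergesRelatively D b g
    · obtain ⟨⟨a, ha⟩, b, hb⟩ := hfg
      obtain ⟨c, hc⟩ := ha.exists_tendsto h hb
      exact ⟨c, fun a' b' ha' hb' => ha.tendsto_of_tendsto h ha' hb hb' hc⟩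
    · exact ⟨0, fun a b ha hb => (hfg ⟨⟨a, ha⟩, b, hb⟩).elim⟩
  choose Q hQ using key
  choose! A hA using fun f (hf : f ∈ Cc X) => exists_convergesRelatively h hD_cc hD_dense hf
  refine ⟨Q, ⟨fun f hf g hg => ?_, fun f hf g hg k hk => ?_, fun c f hf g hg => ?_,
    fun f hf g hg hf0 hg0 => ?_, fun f hf g hg => ?_⟩, ?_⟩
  · refine tendsto_nhds_unique (hQ f g _ _ (hA f hf) (hA g hg)) ?_
    simpa only [h.symm _ ((hA g hg).mem _) _ ((hA f hf).mem _)] using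
      hQ g f _ _ (hA g hg) (hA f hf)
  · refine tendsto_nhds_unique (hQ _ k _ _ ((hA f hf).add h (hA g hg)) (hA k hk)) ?_
    simpa only [h.add_left _ ((hA f hf).mem _) _ ((hA g hg).mem _) _ ((hA k hk).mem _)] using
      (hQ f k _ _ (hA f hf) (hA k hk)).add (hQ g k _ _ (hA g hg) (hA k hk))
  · refine tendsto_nhds_unique (hQ _ g _ _ ((hA f hf).smul h c) (hA g hg)) ?_
    simpa only [h.smul_left c _ ((hA f hf).mem _) _ ((hA g hg).mem _)] using
      (hQ f g _ _ (hA f hf) (hA g hg)).const_mul c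
  · have hfa : ConvergesRelatively D (fun n x => |A f n x|) f := by
      simpa only [abs_of_nonneg (hf0 _)] using (hA f hf).abs h
    have hga : ConvergesRelatively D (fun n x => |A g n x|) g := by
      simpa only [abs_of_nonneg (hg0 _)] using (hA g hg).abs h
    exact ge_of_tendsto' (hQ f g _ _ hfa hga) fun n =>
      h.nonneg _ (hfa.mem n) _ (hga.mem n) (fun _ => abs_nonneg _) fun _ => abs_nonneg _
  · exact tendsto_nhds_unique (hQ f g _ _ (.const h hf) (.const h hg)) tendsto_const_nhds
  · rintro Q' ⟨hsymm, hadd, hsmul, hpos, hext⟩ f hf g hg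
    have h' : IsPositiveForm (Cc X) Q' :=
      ⟨fun f hf g hg => ⟨hf.1.add hg.1, hf.2.add hg.2⟩,
        fun c f hf => ⟨hf.1.const_smul c, hf.2.smul_left (f := fun _ => c)⟩,
        fun f hf => Cc.abs_mem hf, hsymm, hadd, hsmul, hpos⟩
    have hlim := hQ f g _ _ (hA f hf) (hA g hg)
    simp only [← hext _ ((hA f hf).mem _) _ ((hA g hg).mem _)] at hlim
    exact tendsto_nhds_unique tendsto_const_nhds (((hA f hf).mono hD_cc).tendsto_of_tendsto h'
      (.const h' hf) ((hA g hg).mono hD_cc) (.const h' hg) hlim)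
end

section
/- Let X be a locally compact metric space and q a symmetric bilinear form on C_c(X) with q(f,f) ≥ 0 for all f ∈ C_c(X). If q is positive and local, then q is monotone: for all f, g ∈ C_c(X) with |f| ≤ |g| pointwise, one has q(f,f) ≤ q(g,g). In particular, q(f,f) = q(|f|,|f|) for all f ∈ C_c(X). -/
namespace Cc

variable {X : Type*} [TopologicalSpace X]

theorem add_mem {f g : X → ℝ} (hf : f ∈ Cc X) (hg : g ∈ Cc X) : f + g ∈ Cc X :=
  ⟨hf.1.add hg.1, hf.2.add hg.2⟩

theorem comp_mem {φ : ℝ → ℝ} (hφ : Continuous φ) (h0 : φ 0 = 0) {f : X → ℝ} (hf : f ∈ Cc X) :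
    (fun x => φ (f x)) ∈ Cc X :=
  ⟨hφ.comp hf.1, hf.2.comp_left h0⟩

theorem smul_mem (c : ℝ) {f : X → ℝ} (hf : f ∈ Cc X) : c • f ∈ Cc X :=
  comp_mem (φ := fun t => c * t) (by fun_prop) (by simp) hf

theorem abs_mem_s4 {f : X → ℝ} (hf : f ∈ Cc X) : (fun x => |f x|) ∈ Cc X :=
  comp_mem continuous_abs abs_zero hf

theorem form_add_self {q : (X → ℝ) → (X → ℝ) → ℝ}
    (hq_symm : ∀ f ∈ Cc X, ∀ g ∈ Cc X, q f g = q g f)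
    (hq_add : ∀ f ∈ Cc X, ∀ g ∈ Cc X, ∀ h ∈ Cc X, q (f + g) h = q f h + q g h)
    {f g : X → ℝ} (hf : f ∈ Cc X) (hg : g ∈ Cc X) :
    q (f + g) (f + g) = q f f + 2 * q f g + q g g := by
  have hfg := add_mem hf hg
  rw [hq_add f hf g hg _ hfg, hq_symm f hf _ hfg, hq_symm g hg _ hfg,
    hq_add f hf g hg f hf, hq_add f hf g hg g hg, hq_symm g hg f hf]
  ring

theorem form_smul_self {q : (X → ℝ) → (X → ℝ) → ℝ}
    (hq_symm : ∀ f ∈ Cc X, ∀ g ∈ Cc X, q f g = q g f)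
    (hq_smul : ∀ (c : ℝ), ∀ f ∈ Cc X, ∀ g ∈ Cc X, q (c • f) g = c * q f g)
    (c : ℝ) {f : X → ℝ} (hf : f ∈ Cc X) :
    q (c • f) (c • f) = c ^ 2 * q f f := by
  have hcf := smul_mem c hf
  rw [hq_smul c f hf _ hcf, hq_symm f hf _ hcf, hq_smul c f hf f hf]
  ring

end Cc

/-- Let X be a locally compact metric space and q a symmetric
bilinear form on C_c(X) with q(f,f) ≥ 0. If q is positive and local, then q is
monotone: |f| ≤ |g| pointwise implies q(f,f) ≤ q(g,g); in particular
q(f,f) = q(|f|,|f|). -/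
theorem positive_local_implies_monotone
    {X : Type*} [MetricSpace X] [LocallyCompactSpace X]
    (q : (X → ℝ) → (X → ℝ) → ℝ)
    (hq_symm : ∀ f ∈ Cc X, ∀ g ∈ Cc X, q f g = q g f)
    (hq_add : ∀ f ∈ Cc X, ∀ g ∈ Cc X, ∀ h ∈ Cc X, q (f + g) h = q f h + q g h)
    (hq_smul : ∀ (c : ℝ), ∀ f ∈ Cc X, ∀ g ∈ Cc X, q (c • f) g = c * q f g)
    (hq_nonneg : ∀ f ∈ Cc X, 0 ≤ q f f)
    (hq_pos : ∀ f ∈ Cc X, ∀ g ∈ Cc X, (∀ x, 0 ≤ f x) → (∀ x, 0 ≤ g x) → 0 ≤ q f g)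
    (hq_loc : ∀ f ∈ Cc X, ∀ g ∈ Cc X, (∀ x, f x * g x = 0) → q f g = 0) :
    (∀ f ∈ Cc X, ∀ g ∈ Cc X, (∀ x, |f x| ≤ |g x|) → q f f ≤ q g g) ∧
    (∀ f ∈ Cc X, q f f = q (fun x => |f x|) (fun x => |f x|)) := by
  have habs : ∀ f ∈ Cc X, q f f = q (fun x => |f x|) (fun x => |f x|) := by
    intro f hf
    have hp : (fun x => max (f x) 0) ∈ Cc X :=
      Cc.comp_mem (φ := fun t => max t 0) (by fun_prop) (by simp) hf
    have hn : (fun x => max (-f x) 0) ∈ Cc X :=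
      Cc.comp_mem (φ := fun t => max (-t) 0) (by fun_prop) (by simp) hf
    have hdisj : ∀ x, max (f x) 0 * max (-f x) 0 = 0 := by
      intro x
      rcases le_total (f x) 0 with h | h <;> simp [h]
    set p : X → ℝ := fun x => max (f x) 0 with hp_def
    set n : X → ℝ := fun x => max (-f x) 0 with hn_def
    have hf_eq : f = p + (-1 : ℝ) • n := by
      ext x
      rcases le_total (f x) 0 with h | h <;> simp [hp_def, hn_def, h]
    have habs_eq : (fun x => |f x|) = p + n := by
      ext x
      rcases le_total (f x) 0 with h | h <;>
        simp [hp_def, hn_def, h, abs_of_nonneg, abs_of_nonpos]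
    have hm := Cc.smul_mem (-1) hn
    have hpm : q p ((-1 : ℝ) • n) = 0 := by
      rw [hq_symm p hp _ hm, hq_smul _ n hn p hp, hq_symm n hn p hp, hq_loc p hp n hn hdisj,
        mul_zero]
    calc q f f = q (p + (-1 : ℝ) • n) (p + (-1 : ℝ) • n) := by rw [← hf_eq]
      _ = q (p + n) (p + n) := by
        rw [Cc.form_add_self hq_symm hq_add hp hm, Cc.form_add_self hq_symm hq_add hp hn,
          Cc.form_smul_self hq_symm hq_smul _ hn, hpm, hq_loc p hp n hn hdisj]
        ring
      _ = _ := by rw [habs_eq]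
  refine ⟨fun f hf g hg hfg => ?_, habs⟩
  have hu := Cc.abs_mem_s4 hf
  have hv := Cc.abs_mem_s4 hg
  rw [habs f hf, habs g hg]
  set u : X → ℝ := fun x => |f x| with hu_def
  set v : X → ℝ := fun x => |g x| with hv_def
  have hd := Cc.add_mem hv (Cc.smul_mem (-1) hu)
  have hv_eq : v = u + (v + (-1 : ℝ) • u) := by
    ext x
    simp
  have hcross : 0 ≤ q u (v + (-1 : ℝ) • u) :=
    hq_pos u hu _ hd (fun x => abs_nonneg (f x)) (fun x => by simpa [hu_def, hv_def] using hfg x)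
  have hself := hq_nonneg _ hd
  have hexp := Cc.form_add_self hq_symm hq_add hu hd
  rw [← hv_eq] at hexp
  linarith
end

section
/- Let X be a locally compact metric space and q a symmetric bilinear form on C_c(X) with q(f,f) ≥ 0 for all f ∈ C_c(X). If q is monotone, i.e. q(f,f) ≤ q(g,g) whenever |f| ≤ |g| pointwise, then for all f, g ∈ C_c(X) with f·g ≥ 0 pointwise one has q(f,g) ≥ 0. -/
theorem Cc.add_mem_s5 {X : Type*} [TopologicalSpace X] {f g : X → ℝ} (hf : f ∈ Cc X)
    (hg : g ∈ Cc X) : f + g ∈ Cc X :=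
  ⟨hf.1.add hg.1, hf.2.add hg.2⟩

theorem Cc.smul_mem_s5 {X : Type*} [TopologicalSpace X] {f : X → ℝ} (c : ℝ) (hf : f ∈ Cc X) :
    c • f ∈ Cc X :=
  ⟨hf.1.const_smul c, hf.2.smul_left (f := fun _ => c)⟩

theorem abs_le_abs_add_mul_of_mul_nonneg {a b t : ℝ} (ht : 0 ≤ t) (hab : 0 ≤ a * b) :
    |a| ≤ |a + t * b| := by
  rw [← sq_le_sq]
  nlinarith [mul_nonneg ht hab, sq_nonneg (t * b)]

theorem nonneg_of_forall_pos_two_mul_mul_add_sq_mul_nonneg {a b : ℝ} (hb : 0 ≤ b)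
    (h : ∀ t > 0, 0 ≤ 2 * t * a + t ^ 2 * b) : 0 ≤ a := by
  by_contra! ha
  have ht : 0 < -a / (b + 1) := by
    have := neg_pos.mpr ha
    positivity
  have hmul : -a / (b + 1) * (b + 1) = -a := by field_simp
  have := h _ ht
  set t := -a / (b + 1)
  nlinarith [mul_pos ht ht, mul_pos ht (neg_pos.mpr ha)]

/-- Let X be a locally compact metric space and q a symmetric
bilinear form on C_c(X) with q(f,f) ≥ 0. If q is monotone, then f·g ≥ 0
pointwise implies q(f,g) ≥ 0. -/
theorem monotone_implies_positive_on_products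
    {X : Type*} [MetricSpace X] [LocallyCompactSpace X]
    (q : (X → ℝ) → (X → ℝ) → ℝ)
    (hq_symm : ∀ f ∈ Cc X, ∀ g ∈ Cc X, q f g = q g f)
    (hq_add : ∀ f ∈ Cc X, ∀ g ∈ Cc X, ∀ h ∈ Cc X, q (f + g) h = q f h + q g h)
    (hq_smul : ∀ (c : ℝ), ∀ f ∈ Cc X, ∀ g ∈ Cc X, q (c • f) g = c * q f g)
    (hq_nonneg : ∀ f ∈ Cc X, 0 ≤ q f f)
    (hq_mono : ∀ f ∈ Cc X, ∀ g ∈ Cc X, (∀ x, |f x| ≤ |g x|) → q f f ≤ q g g) :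
    ∀ f ∈ Cc X, ∀ g ∈ Cc X, (∀ x, 0 ≤ f x * g x) → 0 ≤ q f g := by
  intro f hf g hg hfg
  refine nonneg_of_forall_pos_two_mul_mul_add_sq_mul_nonneg (hq_nonneg g hg) fun t ht => ?_
  have htg := Cc.smul_mem_s5 t hg
  have hsum := Cc.add_mem_s5 hf htg
  have hmono := hq_mono f hf (f + t • g) hsum fun x =>
    abs_le_abs_add_mul_of_mul_nonneg ht.le (hfg x)
  rw [hq_add f hf _ htg _ hsum, hq_smul t g hg _ hsum, hq_symm f hf _ hsum, hq_symm g hg _ hsum,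
    hq_add f hf _ htg f hf, hq_add f hf _ htg g hg, hq_smul t g hg f hf, hq_smul t g hg g hg,
    hq_symm g hg f hf] at hmono
  linarith
end

section
/- Let X be a locally compact metric space and q a symmetric bilinear form on C_c(X) with q(f,f) ≥ 0 for all f ∈ C_c(X). Suppose that for all f, f', g, g' ∈ C_c(X) the pointwise inequality f·g ≥ f'·g' implies q(f,g) ≥ q(f',g'). Then there exists a Radon measure μ on X such that q(f,g) = ∫_X f·g dμ for all f, g ∈ C_c(X). -/
open MeasureTheory

open CompactlySupported CompactlySupportedContinuousMap

/-- Any two compactly supported continuous functions have a common unit in `C_c(X, ℝ)`. -/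
theorem CompactlySupportedContinuousMap.exists_mul_eq_self {X : Type*} [TopologicalSpace X]
    [T2Space X] [LocallyCompactSpace X] (f g : C_c(X, ℝ)) :
    ∃ u : C_c(X, ℝ), (∀ x, f x * u x = f x) ∧ ∀ x, g x * u x = g x := by
  obtain ⟨u, hu, hsupp, -⟩ := exists_continuousMap_one_of_isCompact_subset_isOpen
    (f.hasCompactSupport.isCompact.union g.hasCompactSupport.isCompact) isOpen_univ
    (Set.subset_univ _)
  refine ⟨⟨u, hasCompactSupport_def.mpr hsupp⟩, fun x ↦ ?_, fun x ↦ ?_⟩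
  · by_cases hx : x ∈ tsupport f
    · exact (congrArg (f x * ·) (hu (Or.inl hx))).trans (mul_one _)
    · simp [image_eq_zero_of_notMem_tsupport hx]
  · by_cases hx : x ∈ tsupport g
    · exact (congrArg (g x * ·) (hu (Or.inr hx))).trans (mul_one _)
    · simp [image_eq_zero_of_notMem_tsupport hx]

/-- Let X be a locally compact metric space and q a symmetric
bilinear form on C_c(X) with q(f,f) ≥ 0, such that f·g ≥ f'·g' pointwise
implies q(f,g) ≥ q(f',g'). Then there is a Radon measure μ on X with
q(f,g) = ∫ f·g dμ for all f, g ∈ C_c(X). -/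
theorem product_monotone_form_is_measure
    {X : Type*} [MetricSpace X] [LocallyCompactSpace X]
    [MeasurableSpace X] [BorelSpace X]
    (q : (X → ℝ) → (X → ℝ) → ℝ)
    (hq_symm : ∀ f ∈ Cc X, ∀ g ∈ Cc X, q f g = q g f)
    (hq_add : ∀ f ∈ Cc X, ∀ g ∈ Cc X, ∀ h ∈ Cc X, q (f + g) h = q f h + q g h)
    (hq_smul : ∀ (c : ℝ), ∀ f ∈ Cc X, ∀ g ∈ Cc X, q (c • f) g = c * q f g)
    (hq_nonneg : ∀ f ∈ Cc X, 0 ≤ q f f)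
    (hq_prod_mono : ∀ f ∈ Cc X, ∀ f' ∈ Cc X, ∀ g ∈ Cc X, ∀ g' ∈ Cc X,
      (∀ x, f' x * g' x ≤ f x * g x) → q f' g' ≤ q f g) :
    ∃ μ : Measure X, μ.Regular ∧
      ∀ f ∈ Cc X, ∀ g ∈ Cc X, q f g = ∫ x, f x * g x ∂μ := by
  have mem (f : C_c(X, ℝ)) : ⇑f ∈ Cc X := ⟨f.continuous, f.hasCompactSupport⟩
  have q_congr (f g f' g' : C_c(X, ℝ)) (h : ∀ x, f x * g x = f' x * g' x) : q f g = q f' g' :=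
    le_antisymm (hq_prod_mono _ (mem _) _ (mem _) _ (mem _) _ (mem _) fun x ↦ (h x).le)
      (hq_prod_mono _ (mem _) _ (mem _) _ (mem _) _ (mem _) fun x ↦ (h x).ge)
  choose u hu _ using fun f : C_c(X, ℝ) ↦ exists_mul_eq_self f f
  have q_unit (f v : C_c(X, ℝ)) (hv : ∀ x, f x * v x = f x) : q f (u f) = q f v :=
    q_congr _ _ _ _ fun x ↦ by rw [hu, hv]
  let Λ : C_c(X, ℝ) →ₚ[ℝ] ℝ :=
    { toFun f := q f (u f)
      map_add' f g := by
        obtain ⟨v, hf, hg⟩ := exists_mul_eq_self f g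
        rw [q_unit f v hf, q_unit g v hg,
          q_unit (f + g) v fun x ↦ by simp [add_mul, hf, hg], coe_add,
          hq_add _ (mem _) _ (mem _) _ (mem _)]
      map_smul' c f := by
        rw [q_unit (c • f) (u f) fun x ↦ by simp [mul_assoc, hu], coe_smul,
          hq_smul _ _ (mem _) _ (mem _)]
        rfl
      monotone' f g hfg := by
        refine hq_prod_mono _ (mem _) _ (mem _) _ (mem _) _ (mem _) fun x ↦ ?_
        rw [hu, hu]
        exact hfg x }
  refine ⟨RealRMK.rieszMeasure Λ, inferInstance, fun f hf g hg ↦ ?_⟩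
  let F : C_c(X, ℝ) := ⟨⟨f, hf.1⟩, hf.2⟩
  let G : C_c(X, ℝ) := ⟨⟨g, hg.1⟩, hg.2⟩
  calc q f g = Λ (F * G) := q_congr F G (F * G) (u (F * G)) fun x ↦ by rw [hu]; rfl
    _ = ∫ x, f x * g x ∂(RealRMK.rieszMeasure Λ) := (RealRMK.integral_rieszMeasure Λ (F * G)).symm
end

section
/- Let X be a locally compact metric space and q a symmetric bilinear form on C_c(X) with q(f,f) ≥ 0 for all f ∈ C_c(X). Then q is positive and local if and only if there exists a Radon measure μ on X such that q(f,f) = ∫_X f² dμ for all f ∈ C_c(X). Moreover, in this case the measure μ is unique. -/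
open MeasureTheory

open scoped CompactlySupported

namespace CompactlySupportedContinuousMap

variable {X : Type*} [TopologicalSpace X]

lemma exists_nonneg_eq_one_of_ne_zero [RegularSpace X] [LocallyCompactSpace X] (f : C_c(X, ℝ)) :
    ∃ χ : C_c(X, ℝ), (∀ x, 0 ≤ χ x) ∧ ∀ x, f x ≠ 0 → χ x = 1 := by
  obtain ⟨χ, h_one, -, h_supp, h_range⟩ := exists_continuous_one_zero_of_isCompact
    f.hasCompactSupport isClosed_empty (Set.disjoint_empty (tsupport f))
  exact ⟨⟨χ, h_supp⟩, fun x ↦ (h_range x).1, fun x hx ↦ h_one (subset_tsupport f hx)⟩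

lemma exists_apply_le (f : C_c(X, ℝ)) : ∃ M : ℝ, ∀ x, f x ≤ M := by
  obtain ⟨M, hM⟩ := f.hasCompactSupport.exists_bound_of_continuous (map_continuous f)
  exact ⟨M, fun x ↦ (le_abs_self _).trans (hM x)⟩

variable {B : C_c(X, ℝ) →ₗ[ℝ] C_c(X, ℝ) →ₗ[ℝ] ℝ}

lemma bilin_congr_right (hloc : ∀ f g, (∀ x, f x * g x = 0) → B f g = 0) {f g h : C_c(X, ℝ)}
    (hgh : ∀ x, f x ≠ 0 → g x = h x) : B f g = B f h := by
  rw [← sub_eq_zero, ← map_sub]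
  refine hloc _ _ fun x ↦ ?_
  rw [sub_apply, mul_eq_zero, sub_eq_zero]
  exact or_iff_not_imp_left.2 (hgh x)

lemma abs_bilin_self_sub_le (hsymm : ∀ f g, B f g = B g f)
    (hpos : ∀ f g, (∀ x, 0 ≤ f x) → (∀ x, 0 ≤ g x) → 0 ≤ B f g)
    (hloc : ∀ f g, (∀ x, f x * g x = 0) → B f g = 0) {χ : C_c(X, ℝ)} (hχ : ∀ x, 0 ≤ χ x)
    {ε : ℝ} (hε : 0 ≤ ε) (n : ℕ) (f : C_c(X, ℝ)) (hf : ∀ x, 0 ≤ f x) (hfn : ∀ x, f x ≤ n * ε)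
    (hfχ : ∀ x, f x ≠ 0 → χ x = 1) : |B f f - B (f * f) χ| ≤ ε * B f χ := by
  have base (g : C_c(X, ℝ)) (hg : ∀ x, 0 ≤ g x) (hgε : ∀ x, g x ≤ ε)
      (hgχ : ∀ x, g x ≠ 0 → χ x = 1) : |B g g - B (g * g) χ| ≤ ε * B g χ := by
    have h₁ : 0 ≤ B g (ε • χ - g) := by
      refine hpos _ _ hg fun x ↦ ?_
      rw [sub_apply, smul_apply, smul_eq_mul, sub_nonneg]
      by_cases hx : g x = 0
      · rw [hx]
        exact mul_nonneg hε (hχ x)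
      · rw [hgχ x hx, mul_one]
        exact hgε x
    have h₂ : 0 ≤ B (ε • g - g * g) χ := by
      refine hpos _ _ (fun x ↦ ?_) hχ
      rw [sub_apply, smul_apply, smul_eq_mul, mul_apply, sub_nonneg]
      exact mul_le_mul_of_nonneg_right (hgε x) (hg x)
    have h₃ : 0 ≤ B g g := hpos _ _ hg hg
    have h₄ : 0 ≤ B (g * g) χ := hpos _ _ (fun x ↦ mul_self_nonneg (g x)) hχ
    simp only [map_sub, map_smul, LinearMap.sub_apply, LinearMap.smul_apply, smul_eq_mul] at h₁ h₂
    rw [abs_le]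
    constructor <;> linarith
  induction n generalizing f with
  | zero =>
    refine base f hf (fun x ↦ (hfn x).trans ?_) hfχ
    simpa using hε
  | succ n ih =>
    let g : C_c(X, ℝ) := f.compLeft ⟨fun t ↦ min t ε, by fun_prop⟩
    let h : C_c(X, ℝ) := f.compLeft ⟨fun t ↦ max (t - ε) 0, by fun_prop⟩
    have hg (x) : g x = min (f x) ε := compLeft_apply (by simpa using hε) f x
    have hh (x) : h x = max (f x - ε) 0 := compLeft_apply (by simpa using hε) f x
    have hf_eq : f = g + h := by
      ext x
      rw [add_apply, hg, hh]
      rcases le_total (f x) ε with hx | hx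
      · rw [min_eq_left hx, max_eq_right (by linarith), add_zero]
      · rw [min_eq_right hx, max_eq_left (by linarith)]
        ring
    have hf_ne {x} (hx : h x ≠ 0) : ε < f x := by
      contrapose! hx
      rw [hh, max_eq_right (by linarith)]
    have hhχ (x) (hx : h x ≠ 0) : χ x = 1 := hfχ x (hε.trans_lt (hf_ne hx)).ne'
    have h_mul : g * h = ε • h := by
      ext x
      rw [mul_apply, smul_apply, smul_eq_mul]
      by_cases hx : h x = 0
      · simp [hx]
      · rw [hg, min_eq_right (hf_ne hx).le]
    have h_cross : B h g = ε * B h χ := by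
      rw [← smul_eq_mul, ← map_smul]
      refine bilin_congr_right hloc fun x hx ↦ ?_
      rw [hg, min_eq_right (hf_ne hx).le, smul_apply, hhχ x hx, smul_eq_mul, mul_one]
    have hg_le := base g (fun x ↦ by rw [hg]; exact le_min (hf x) hε)
      (fun x ↦ by rw [hg]; exact min_le_right _ _)
      fun x hx ↦ hfχ x fun h0 ↦ hx (by rw [hg, h0, min_eq_left hε])
    have hh_le := ih h (fun x ↦ by rw [hh]; exact le_max_right _ _)
      (fun x ↦ by
        rw [hh]
        have := hfn x
        push_cast at this
        exact max_le (by linarith) (by positivity)) hhχ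
    have h_sq : f * f = g * g + h * h + (2 * ε) • h := by
      rw [hf_eq, mul_smul, ← h_mul, two_smul, add_mul, mul_add, mul_add, mul_comm h g]
      abel
    have h_diff : B f f - B (f * f) χ = (B g g - B (g * g) χ) + (B h h - B (h * h) χ) := by
      rw [h_sq, hf_eq]
      simp only [map_add, map_smul, LinearMap.add_apply, LinearMap.smul_apply, smul_eq_mul,
        hsymm g h, h_cross]
      ring
    calc |B f f - B (f * f) χ| ≤ |B g g - B (g * g) χ| + |B h h - B (h * h) χ| := by
          rw [h_diff]
          exact abs_add_le _ _
      _ ≤ ε * B g χ + ε * B h χ := add_le_add hg_le hh_le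
      _ = ε * B f χ := by rw [hf_eq, map_add, LinearMap.add_apply, mul_add]

lemma bilin_self_eq_of_nonneg (hsymm : ∀ f g, B f g = B g f)
    (hpos : ∀ f g, (∀ x, 0 ≤ f x) → (∀ x, 0 ≤ g x) → 0 ≤ B f g)
    (hloc : ∀ f g, (∀ x, f x * g x = 0) → B f g = 0) {f χ : C_c(X, ℝ)} (hχ : ∀ x, 0 ≤ χ x)
    (hf : ∀ x, 0 ≤ f x) (hfχ : ∀ x, f x ≠ 0 → χ x = 1) : B f f = B (f * f) χ := by
  obtain ⟨M, hM⟩ := f.exists_apply_le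
  have h_nonneg : 0 ≤ B f χ := hpos _ _ hf hχ
  rw [← sub_eq_zero, ← abs_nonpos_iff]
  refine le_of_forall_pos_le_add fun δ hδ ↦ ?_
  have hε : 0 < δ / (B f χ + 1) := by positivity
  obtain ⟨n, hn⟩ := exists_nat_ge (M / (δ / (B f χ + 1)))
  refine (abs_bilin_self_sub_le hsymm hpos hloc hχ hε.le n f hf
    (fun x ↦ (hM x).trans ((div_le_iff₀ hε).1 hn)) hfχ).trans ?_
  rw [zero_add, div_mul_eq_mul_div, div_le_iff₀ (by positivity)]
  exact mul_le_mul_of_nonneg_left (by linarith) hδ.le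

/-- A symmetric, positive and local bilinear form on `C_c(X, ℝ)` depends on `(f, f)` only through
the product `f * f`. -/
lemma bilin_self_eq (hsymm : ∀ f g, B f g = B g f)
    (hpos : ∀ f g, (∀ x, 0 ≤ f x) → (∀ x, 0 ≤ g x) → 0 ≤ B f g)
    (hloc : ∀ f g, (∀ x, f x * g x = 0) → B f g = 0) {f χ : C_c(X, ℝ)} (hχ : ∀ x, 0 ≤ χ x)
    (hfχ : ∀ x, f x ≠ 0 → χ x = 1) : B f f = B (f * f) χ := by
  let g : C_c(X, ℝ) := f.compLeft ⟨fun t ↦ max t 0, by fun_prop⟩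
  let h : C_c(X, ℝ) := f.compLeft ⟨fun t ↦ max (-t) 0, by fun_prop⟩
  have hg (x) : g x = max (f x) 0 := compLeft_apply (by simp) f x
  have hh (x) : h x = max (-f x) 0 := compLeft_apply (by simp) f x
  have hf_eq : f = g - h := by
    ext x
    rw [sub_apply, hg, hh]
    rcases le_total (f x) 0 with hx | hx <;> simp [hx]
  have hgh (x) : g x * h x = 0 := by
    rw [hg, hh]
    rcases le_total (f x) 0 with hx | hx <;> simp [hx]
  have h_mul : g * h = 0 := ext hgh
  have h_sq : f * f = g * g + h * h := by
    rw [hf_eq, sub_mul, mul_sub, mul_sub, mul_comm h g, h_mul]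
    abel
  have hgχ (x) (hx : g x ≠ 0) : χ x = 1 := hfχ x fun h0 ↦ hx (by simp [hg, h0])
  have hhχ (x) (hx : h x ≠ 0) : χ x = 1 := hfχ x fun h0 ↦ hx (by simp [hh, h0])
  rw [h_sq, hf_eq]
  simp only [map_add, map_sub, LinearMap.add_apply, LinearMap.sub_apply, hsymm h g, hloc g h hgh]
  rw [bilin_self_eq_of_nonneg hsymm hpos hloc hχ (fun x ↦ by simp [hg]) hgχ,
    bilin_self_eq_of_nonneg hsymm hpos hloc hχ (fun x ↦ by simp [hh]) hhχ]
  ring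

variable [MeasurableSpace X] [BorelSpace X]

theorem exists_regular_bilin_self_eq_integral [T2Space X] [LocallyCompactSpace X]
    (hsymm : ∀ f g, B f g = B g f)
    (hpos : ∀ f g, (∀ x, 0 ≤ f x) → (∀ x, 0 ≤ g x) → 0 ≤ B f g)
    (hloc : ∀ f g, (∀ x, f x * g x = 0) → B f g = 0) :
    ∃ μ : Measure X, μ.Regular ∧ ∀ f : C_c(X, ℝ), B f f = ∫ x, f x ^ 2 ∂μ := by
  choose χ hχ_nonneg hχ using exists_nonneg_eq_one_of_ne_zero (X := X)
  have h_eq {f u : C_c(X, ℝ)} (hu : ∀ x, f x ≠ 0 → u x = 1) : B f (χ f) = B f u :=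
    bilin_congr_right hloc fun x hx ↦ (hχ f x hx).trans (hu x hx).symm
  let L : C_c(X, ℝ) →ₗ[ℝ] ℝ :=
    { toFun f := B f (χ f)
      map_add' f g := by
        let u : C_c(X, ℝ) := χ f + χ g - χ f * χ g
        have hu (x) : u x = 1 - (1 - χ f x) * (1 - χ g x) := by
          simp only [u, add_apply, sub_apply, mul_apply]
          ring
        have huf (x) (hx : f x ≠ 0) : u x = 1 := by simp [hu, hχ f x hx]
        have hug (x) (hx : g x ≠ 0) : u x = 1 := by simp [hu, hχ g x hx]
        have hufg (x) (hx : (f + g) x ≠ 0) : u x = 1 := by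
          by_cases h0 : f x = 0
          · exact hug x fun h1 ↦ hx (by simp [h0, h1])
          · exact huf x h0
        rw [h_eq huf, h_eq hug, h_eq hufg, map_add, LinearMap.add_apply]
      map_smul' c f := by
        have hu (x) (hx : (c • f) x ≠ 0) : χ f x = 1 := hχ f x fun h0 ↦ hx (by simp [h0])
        rw [h_eq hu, map_smul, LinearMap.smul_apply, RingHom.id_apply] }
  let Λ : C_c(X, ℝ) →ₚ[ℝ] ℝ :=
    PositiveLinearMap.mk₀ L fun f hf ↦ hpos _ _ (fun x ↦ hf x) (hχ_nonneg f)
  refine ⟨RealRMK.rieszMeasure Λ, inferInstance, fun f ↦ ?_⟩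
  have h_int : ∫ x, (f * f) x ∂(RealRMK.rieszMeasure Λ) = B (f * f) (χ (f * f)) :=
    RealRMK.integral_rieszMeasure Λ (f * f)
  have h_sq (x) (hx : (f * f) x ≠ 0) : χ f x = 1 := hχ f x fun h0 ↦ hx (by simp [h0])
  rw [bilin_self_eq hsymm hpos hloc (hχ_nonneg f) (hχ f), ← h_eq h_sq, ← h_int]
  simp only [mul_apply, sq]

lemma bilin_eq_integral_mul (hsymm : ∀ f g, B f g = B g f) {μ : Measure X}
    [IsFiniteMeasureOnCompacts μ] (hμ : ∀ f : C_c(X, ℝ), B f f = ∫ x, f x ^ 2 ∂μ)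
    (f g : C_c(X, ℝ)) : B f g = ∫ x, f x * g x ∂μ := by
  have h_add := hμ (f + g)
  have h_int (u v : C_c(X, ℝ)) : Integrable (fun x ↦ u x * v x) μ := (u * v).integrable
  have h_exp : ∫ x, (f + g) x ^ 2 ∂μ
      = ∫ x, f x ^ 2 ∂μ + ∫ x, g x ^ 2 ∂μ + 2 * ∫ x, f x * g x ∂μ := by
    have h (x) : (f + g) x ^ 2 = f x * f x + g x * g x + 2 * (f x * g x) := by
      rw [add_apply]
      ring
    simp only [h]
    have h_int_add : Integrable (fun x ↦ f x * f x + g x * g x) μ := (h_int f f).add (h_int g g)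
    rw [integral_add h_int_add ((h_int f g).const_mul 2),
      integral_add (h_int f f) (h_int g g), integral_const_mul]
    simp only [sq]
  rw [h_exp, ← hμ, ← hμ] at h_add
  simp only [map_add, LinearMap.add_apply, hsymm g f] at h_add
  linarith

end CompactlySupportedContinuousMap

lemma mem_Cc {X : Type*} [TopologicalSpace X] (f : C_c(X, ℝ)) : ⇑f ∈ Cc X :=
  ⟨map_continuous f, f.hasCompactSupport⟩

/-- Let X be a locally compact metric space and q a symmetric
bilinear form on C_c(X) with q(f,f) ≥ 0. Then q is positive and local iff
there is a Radon measure μ with q(f,f) = ∫ f² dμ for all f ∈ C_c(X); moreover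
such a measure is unique. -/
theorem positive_local_iff_measure
    {X : Type*} [MetricSpace X] [LocallyCompactSpace X]
    [MeasurableSpace X] [BorelSpace X]
    (q : (X → ℝ) → (X → ℝ) → ℝ)
    (hq_symm : ∀ f ∈ Cc X, ∀ g ∈ Cc X, q f g = q g f)
    (hq_add : ∀ f ∈ Cc X, ∀ g ∈ Cc X, ∀ h ∈ Cc X, q (f + g) h = q f h + q g h)
    (hq_smul : ∀ (c : ℝ), ∀ f ∈ Cc X, ∀ g ∈ Cc X, q (c • f) g = c * q f g)
    (hq_nonneg : ∀ f ∈ Cc X, 0 ≤ q f f) :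
    (((∀ f ∈ Cc X, ∀ g ∈ Cc X, (∀ x, 0 ≤ f x) → (∀ x, 0 ≤ g x) → 0 ≤ q f g) ∧
      (∀ f ∈ Cc X, ∀ g ∈ Cc X, (∀ x, f x * g x = 0) → q f g = 0)) ↔
      (∃ μ : Measure X, μ.Regular ∧ ∀ f ∈ Cc X, q f f = ∫ x, (f x) ^ 2 ∂μ)) ∧
    (∀ μ ν : Measure X, μ.Regular → ν.Regular →
      (∀ f ∈ Cc X, q f f = ∫ x, (f x) ^ 2 ∂μ) →
      (∀ f ∈ Cc X, q f f = ∫ x, (f x) ^ 2 ∂ν) → μ = ν) := by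
  let B : C_c(X, ℝ) →ₗ[ℝ] C_c(X, ℝ) →ₗ[ℝ] ℝ := LinearMap.mk₂ ℝ (fun f g ↦ q f g)
    (fun f g h ↦ hq_add f (mem_Cc f) g (mem_Cc g) h (mem_Cc h))
    (fun c f g ↦ hq_smul c f (mem_Cc f) g (mem_Cc g))
    (fun f g h ↦ by
      have hgh := mem_Cc (g + h)
      rw [CompactlySupportedContinuousMap.coe_add] at hgh
      rw [CompactlySupportedContinuousMap.coe_add, hq_symm f (mem_Cc f) _ hgh,
        hq_add g (mem_Cc g) h (mem_Cc h) f (mem_Cc f), hq_symm g (mem_Cc g) f (mem_Cc f),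
        hq_symm h (mem_Cc h) f (mem_Cc f)])
    (fun c f g ↦ by
      have hcg := mem_Cc (c • g)
      rw [CompactlySupportedContinuousMap.coe_smul] at hcg
      rw [CompactlySupportedContinuousMap.coe_smul, hq_symm f (mem_Cc f) _ hcg,
        hq_smul c g (mem_Cc g) f (mem_Cc f), hq_symm g (mem_Cc g) f (mem_Cc f), smul_eq_mul])
  have hB (f g : C_c(X, ℝ)) : B f g = q f g := LinearMap.mk₂_apply ..
  have hB_symm (f g : C_c(X, ℝ)) : B f g = B g f := hq_symm f (mem_Cc f) g (mem_Cc g)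
  have h_rep {μ : Measure X} (hμ : μ.Regular) (h : ∀ f ∈ Cc X, q f f = ∫ x, f x ^ 2 ∂μ)
      (f g : C_c(X, ℝ)) : q f g = ∫ x, f x * g x ∂μ :=
    CompactlySupportedContinuousMap.bilin_eq_integral_mul hB_symm
      (fun f ↦ h f (mem_Cc f)) f g
  refine ⟨⟨fun ⟨hpos, hloc⟩ ↦ ?_, fun ⟨μ, hμ, h⟩ ↦ ⟨fun f hf g hg hf0 hg0 ↦ ?_,
    fun f hf g hg hfg ↦ ?_⟩⟩, fun μ ν hμ hν hqμ hqν ↦ ?_⟩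
  · obtain ⟨μ, hμ, h⟩ :=
      CompactlySupportedContinuousMap.exists_regular_bilin_self_eq_integral hB_symm
        (fun f g ↦ hpos f (mem_Cc f) g (mem_Cc g)) (fun f g ↦ hloc f (mem_Cc f) g (mem_Cc g))
    exact ⟨μ, hμ, fun f hf ↦ h ⟨⟨f, hf.1⟩, hf.2⟩⟩
  · rw [show q f g = _ from h_rep hμ h ⟨⟨f, hf.1⟩, hf.2⟩ ⟨⟨g, hg.1⟩, hg.2⟩]
    exact integral_nonneg fun x ↦ mul_nonneg (hf0 x) (hg0 x)
  · rw [show q f g = _ from h_rep hμ h ⟨⟨f, hf.1⟩, hf.2⟩ ⟨⟨g, hg.1⟩, hg.2⟩]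
    exact integral_eq_zero_of_ae (.of_forall hfg)
  · refine Measure.ext_of_integral_eq_on_compactlySupported fun f ↦ ?_
    obtain ⟨χ, -, hχ⟩ := f.exists_nonneg_eq_one_of_ne_zero
    have h_mul (x) : f x * χ x = f x := by
      by_cases hx : f x = 0
      · rw [hx, zero_mul]
      · rw [hχ x hx, mul_one]
    have := (h_rep hμ hqμ f χ).symm.trans (h_rep hν hqν f χ)
    simpa only [h_mul] using this
end

section
/- Let X be a locally compact metric space, D a linear sublattice of C_c(X) that is dense in C_c(X) with respect to the supremum norm, and q a positive and local symmetric bilinear form on D with q(f,f) ≥ 0 for all f ∈ D. Then there exists a unique Radon measure μ on X such that q(f,f) = ∫_X f² dμ for all f ∈ D. -/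
open MeasureTheory

open CompactlySupported

section DenseSublattice

variable {X : Type*} [TopologicalSpace X]

lemma le_of_forall_pos_le_add_mul {a b c : ℝ} (h : ∀ ε > 0, a ≤ b + ε * c) : a ≤ b := by
  refine le_of_forall_pos_le_add fun δ hδ ↦ (h (δ / (|c| + 1)) (by positivity)).trans ?_
  have h1 : δ / (|c| + 1) * c ≤ δ := by
    rw [div_mul_eq_mul_div, div_le_iff₀ (by positivity)]
    nlinarith [le_abs_self c]
  linarith

/-- A linear functional on `C_c(X, ℝ)` that is nonnegative on nonnegative functions. -/
def IsPositiveFunctional (L : C_c(X, ℝ) →ₗ[ℝ] ℝ) : Prop :=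
  ∀ φ : C_c(X, ℝ), (∀ x, 0 ≤ φ x) → 0 ≤ L φ

lemma IsPositiveFunctional.mono {L : C_c(X, ℝ) →ₗ[ℝ] ℝ} (hL : IsPositiveFunctional L)
    {φ ψ : C_c(X, ℝ)} (h : ∀ x, φ x ≤ ψ x) : L φ ≤ L ψ := by
  have := hL (ψ - φ) fun x ↦ by simpa using h x
  rwa [map_sub, sub_nonneg] at this

lemma IsPositiveFunctional.abs_sub_le {L : C_c(X, ℝ) →ₗ[ℝ] ℝ} (hL : IsPositiveFunctional L)
    {φ ψ η : C_c(X, ℝ)} {ε : ℝ} (h : ∀ x, |φ x - ψ x| ≤ ε * η x) :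
    |L φ - L ψ| ≤ ε * L η := by
  have h1 := hL.mono (φ := φ) (ψ := ψ + ε • η) fun x ↦ by
    have := (abs_le.1 (h x)).2
    simp; linarith
  have h2 := hL.mono (φ := ψ) (ψ := φ + ε • η) fun x ↦ by
    have := (abs_le.1 (h x)).1
    simp; linarith
  simp only [map_add, map_smul, smul_eq_mul] at h1 h2
  rw [abs_le]
  constructor <;> linarith

lemma exists_forall_abs_le (φ : C_c(X, ℝ)) : ∃ C, 0 ≤ C ∧ ∀ x, |φ x| ≤ C := by
  obtain ⟨C, hC⟩ := φ.hasCompactSupport.exists_bound_of_continuous φ.continuous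
  exact ⟨max C 0, le_max_right _ _, fun x ↦ (hC x).trans (le_max_left _ _)⟩

/-- A uniformly dense linear sublattice of `C_c(X, ℝ)`. -/
structure IsDenseSublattice (D : Submodule ℝ C_c(X, ℝ)) : Prop where
  sup_mem : ∀ f ∈ D, ∀ g ∈ D, f ⊔ g ∈ D
  dense : ∀ φ : C_c(X, ℝ), ∀ ε > 0, ∃ f ∈ D, ∀ x, |f x - φ x| < ε

namespace IsDenseSublattice

variable {D : Submodule ℝ C_c(X, ℝ)}

lemma inf_mem (hD : IsDenseSublattice D) {f g : C_c(X, ℝ)} (hf : f ∈ D) (hg : g ∈ D) :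
    f ⊓ g ∈ D := by
  have : f ⊓ g = -((-f) ⊔ (-g)) := by
    ext x
    simp [max_neg_neg]
  rw [this]
  exact D.neg_mem (hD.sup_mem _ (D.neg_mem hf) _ (D.neg_mem hg))

variable [T2Space X] [LocallyCompactSpace X]

lemma exists_one_le (hD : IsDenseSublattice D) {K : Set X} (hK : IsCompact K) :
    ∃ k ∈ D, (∀ x, 0 ≤ k x) ∧ ∀ x ∈ K, 1 ≤ k x := by
  obtain ⟨u, hu, -, hcs, -⟩ := exists_continuous_one_zero_of_isCompact hK isClosed_empty
    (Set.disjoint_empty K)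
  obtain ⟨f, hf, hfu⟩ := hD.dense ((2 : ℝ) • ⟨u, hcs⟩) 1 one_pos
  refine ⟨f ⊔ 0, hD.sup_mem _ hf _ D.zero_mem, fun x ↦ by simp, fun x hx ↦ ?_⟩
  have h1 := (abs_lt.1 (hfu x)).1
  have h2 : u x = 1 := hu hx
  simp [h2] at h1
  simp only [CompactlySupportedContinuousMap.sup_apply, le_sup_iff]
  left; linarith

lemma exists_approx (hD : IsDenseSublattice D) (φ : C_c(X, ℝ)) :
    ∃ k ∈ D, (∀ x, 0 ≤ k x) ∧ ∀ ε > 0, ∃ f ∈ D, ∀ x, |f x - φ x| ≤ ε * k x := by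
  obtain ⟨h, hh, hh0, hh1⟩ := hD.exists_one_le φ.hasCompactSupport
  obtain ⟨k, hk, hk0, hk1⟩ :=
    hD.exists_one_le (K := tsupport φ ∪ tsupport h)
      (IsCompact.union φ.hasCompactSupport h.hasCompactSupport)
  obtain ⟨C, hC0, hC⟩ := exists_forall_abs_le φ
  refine ⟨k, hk, hk0, fun ε hε ↦ ?_⟩
  obtain ⟨f, hf, hfφ⟩ := hD.dense φ (min ε 1) (by positivity)
  have hCh : (C + 1) • h ∈ D := D.smul_mem _ hh
  refine ⟨(f ⊓ ((C + 1) • h)) ⊔ (-((C + 1) • h)),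
    hD.sup_mem _ (hD.inf_mem hf hCh) _ (D.neg_mem hCh), fun x ↦ ?_⟩
  obtain ⟨hx1, hx2⟩ := lt_min_iff.1 (hfφ x)
  simp only [CompactlySupportedContinuousMap.sup_apply, CompactlySupportedContinuousMap.inf_apply,
    CompactlySupportedContinuousMap.neg_apply, CompactlySupportedContinuousMap.smul_apply,
    smul_eq_mul]
  by_cases hx : x ∈ tsupport φ
  · have hCx := abs_le.1 (hC x)
    have hhx : C + 1 ≤ (C + 1) * h x := le_mul_of_one_le_right (by positivity) (hh1 x hx)
    have hkx : ε ≤ ε * k x := le_mul_of_one_le_right hε.le (hk1 x (Or.inl hx))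
    have h2 := abs_lt.1 hx2
    rw [inf_of_le_left (by linarith), sup_of_le_left (by linarith)]
    linarith
  · have hφx : φ x = 0 := image_eq_zero_of_notMem_tsupport hx
    by_cases hxh : x ∈ tsupport h
    · have hkx : ε ≤ ε * k x := le_mul_of_one_le_right hε.le (hk1 x (Or.inr hxh))
      have hhx : 0 ≤ (C + 1) * h x := mul_nonneg (by positivity) (hh0 x)
      rw [hφx, sub_zero] at hx1 ⊢
      have h1 := abs_lt.1 hx1
      rw [abs_le]
      refine ⟨le_sup_of_le_left (le_inf ?_ ?_), sup_le (inf_le_of_left_le ?_) ?_⟩ <;> linarith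
    · have hhx : h x = 0 := image_eq_zero_of_notMem_tsupport hxh
      have : 0 ≤ ε * k x := mul_nonneg hε.le (hk0 x)
      simpa [hhx, hφx] using this

/-- Positive linear functionals are determined by their values on a dense sublattice. -/
lemma eq_of_forall_mem (hD : IsDenseSublattice D) {L₁ L₂ : C_c(X, ℝ) →ₗ[ℝ] ℝ}
    (h₁ : IsPositiveFunctional L₁) (h₂ : IsPositiveFunctional L₂)
    (h : ∀ f ∈ D, L₁ f = L₂ f) : L₁ = L₂ := by
  ext φ
  obtain ⟨k, hk, hk0, hφ⟩ := hD.exists_approx φ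
  refine eq_of_abs_sub_nonpos (le_of_forall_pos_le_add_mul (c := L₁ k + L₂ k) fun ε hε ↦ ?_)
  obtain ⟨f, hf, hfφ⟩ := hφ ε hε
  have e1 := abs_le.1 (h₁.abs_sub_le hfφ)
  have e2 := abs_le.1 (h₂.abs_sub_le hfφ)
  have e3 := h f hf
  rw [abs_le]
  constructor <;> linarith

/-- Positive functionals on a dense sublattice extend to positive functionals on `C_c(X, ℝ)`. -/
lemma exists_extension (hD : IsDenseSublattice D) (ℓ : D →ₗ[ℝ] ℝ)
    (hℓ : ∀ f : D, (∀ x, 0 ≤ (f : C_c(X, ℝ)) x) → 0 ≤ ℓ f) :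
    ∃ L : C_c(X, ℝ) →ₗ[ℝ] ℝ, IsPositiveFunctional L ∧ ∀ f : D, L f = ℓ f := by
  let s : PointedCone ℝ C_c(X, ℝ) :=
    { carrier := {φ | ∀ x, 0 ≤ φ x}
      add_mem' := fun {φ ψ} hφ hψ x ↦ by simpa using add_nonneg (hφ x) (hψ x)
      zero_mem' := fun x ↦ by simp
      smul_mem' := fun c φ hφ x ↦ mul_nonneg c.2 (hφ x) }
  obtain ⟨L, hL, hpos⟩ := riesz_extension s ⟨D, ℓ⟩ hℓ fun φ ↦ by
    obtain ⟨k, hk, hk0, hk1⟩ := hD.exists_one_le φ.hasCompactSupport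
    obtain ⟨C, hC0, hC⟩ := exists_forall_abs_le φ
    refine ⟨⟨C • k, D.smul_mem _ hk⟩, fun x ↦ ?_⟩
    change 0 ≤ C * k x + φ x
    by_cases hx : x ∈ tsupport φ
    · nlinarith [abs_le.1 (hC x), hk1 x hx]
    · rw [image_eq_zero_of_notMem_tsupport hx]
      nlinarith [hk0 x]
  exact ⟨L, hpos, hL⟩

end IsDenseSublattice

/-- `L g` is a positive functional extending `B · g`, for each nonnegative `g`. -/
structure RepresentsForm {D : Submodule ℝ C_c(X, ℝ)} (B : D →ₗ[ℝ] D →ₗ[ℝ] ℝ)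
    (L : D → C_c(X, ℝ) →ₗ[ℝ] ℝ) : Prop where
  positive : ∀ g : D, (∀ x, 0 ≤ (g : C_c(X, ℝ)) x) → IsPositiveFunctional (L g)
  apply_coe : ∀ g : D, (∀ x, 0 ≤ (g : C_c(X, ℝ)) x) → ∀ f : D, L g f = B f g

/-- A positive symmetric bilinear form that vanishes on pairs of functions with zero product. -/
structure IsPositiveLocal {D : Submodule ℝ C_c(X, ℝ)} (B : D →ₗ[ℝ] D →ₗ[ℝ] ℝ) : Prop where
  symm : ∀ f g, B f g = B g f
  nonneg : ∀ f g : D, (∀ x, 0 ≤ (f : C_c(X, ℝ)) x) → (∀ x, 0 ≤ (g : C_c(X, ℝ)) x) → 0 ≤ B f g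
  eq_zero : ∀ f g : D, (∀ x, (f : C_c(X, ℝ)) x * (g : C_c(X, ℝ)) x = 0) → B f g = 0

namespace RepresentsForm

variable {D : Submodule ℝ C_c(X, ℝ)} {B : D →ₗ[ℝ] D →ₗ[ℝ] ℝ}
  {L : D → C_c(X, ℝ) →ₗ[ℝ] ℝ} [T2Space X] [LocallyCompactSpace X]

lemma map_add (hL : RepresentsForm B L) (hD : IsDenseSublattice D) {g h : D}
    (hg : ∀ x, 0 ≤ (g : C_c(X, ℝ)) x) (hh : ∀ x, 0 ≤ (h : C_c(X, ℝ)) x) :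
    L (g + h) = L g + L h := by
  have hgh : ∀ x, 0 ≤ ((g + h : D) : C_c(X, ℝ)) x := fun x ↦ add_nonneg (hg x) (hh x)
  refine hD.eq_of_forall_mem (hL.positive _ hgh)
    (fun φ hφ ↦ add_nonneg (hL.positive g hg φ hφ) (hL.positive h hh φ hφ)) fun f hf ↦ ?_
  have e1 := hL.apply_coe _ hgh ⟨f, hf⟩
  have e2 := hL.apply_coe g hg ⟨f, hf⟩
  have e3 := hL.apply_coe h hh ⟨f, hf⟩
  simp only [_root_.map_add] at e1
  simp only [LinearMap.add_apply]
  linarith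

lemma map_smul (hL : RepresentsForm B L) (hD : IsDenseSublattice D) {g : D} {c : ℝ}
    (hg : ∀ x, 0 ≤ (g : C_c(X, ℝ)) x) (hc : 0 ≤ c) : L (c • g) = c • L g := by
  have hcg : ∀ x, 0 ≤ ((c • g : D) : C_c(X, ℝ)) x := fun x ↦ mul_nonneg hc (hg x)
  refine hD.eq_of_forall_mem (hL.positive _ hcg)
    (fun φ hφ ↦ mul_nonneg hc (hL.positive g hg φ hφ)) fun f hf ↦ ?_
  have e1 := hL.apply_coe _ hcg ⟨f, hf⟩
  have e2 := hL.apply_coe g hg ⟨f, hf⟩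
  simp only [_root_.map_smul, smul_eq_mul] at e1
  simp only [LinearMap.smul_apply, smul_eq_mul, e2, e1]

lemma apply_le_apply (hL : RepresentsForm B L) (hB : IsPositiveLocal B)
    (hD : IsDenseSublattice D) {g h : D}
    (hg : ∀ x, 0 ≤ (g : C_c(X, ℝ)) x) (hh : ∀ x, 0 ≤ (h : C_c(X, ℝ)) x)
    {φ : C_c(X, ℝ)} (hφ : ∀ x, 0 ≤ φ x)
    (hgh : ∀ x, φ x ≠ 0 → (g : C_c(X, ℝ)) x ≤ (h : C_c(X, ℝ)) x) : L g φ ≤ L h φ := by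
  obtain ⟨k, hk, hk0, hk1⟩ := hD.exists_approx φ
  refine le_of_forall_pos_le_add_mul (c := 2 * L g k) fun ε hε ↦ ?_
  obtain ⟨f', hf', hfφ⟩ := hk1 ε hε
  let f : D := ⟨(f' - ε • k) ⊔ 0, hD.sup_mem _ (D.sub_mem hf' (D.smul_mem _ hk)) _ D.zero_mem⟩
  have hfx : ∀ x, (f : C_c(X, ℝ)) x = max (f' x - ε * k x) 0 := fun x ↦ rfl
  have hf0 : ∀ x, 0 ≤ (f : C_c(X, ℝ)) x := fun x ↦ le_max_right _ _
  have hfle : ∀ x, (f : C_c(X, ℝ)) x ≤ φ x := fun x ↦ by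
    rw [hfx]
    exact max_le (by linarith [abs_le.1 (hfφ x)]) (hφ x)
  have hfz : ∀ x, φ x = 0 → (f : C_c(X, ℝ)) x = 0 := fun x hx ↦
    le_antisymm (hx ▸ hfle x) (hf0 x)
  have hclose : ∀ x, |φ x - (f : C_c(X, ℝ)) x| ≤ (2 * ε) * k x := fun x ↦ by
    rw [abs_of_nonneg (sub_nonneg.2 (hfle x)), hfx]
    linarith [abs_le.1 (hfφ x), le_max_left (f' x - ε * k x) 0]
  let u : D := ⟨(g - h) ⊔ 0, hD.sup_mem _ (D.sub_mem g.2 h.2) _ D.zero_mem⟩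
  have hfu : B f u = 0 := hB.eq_zero f u fun x ↦ by
    by_cases hx : φ x = 0
    · rw [hfz x hx, zero_mul]
    · have : (u : C_c(X, ℝ)) x = 0 := max_eq_right (sub_nonpos.2 (hgh x hx))
      rw [this, mul_zero]
  have hle : 0 ≤ B f (h + u + (-1 : ℝ) • g) := hB.nonneg _ _ hf0 fun x ↦ by
    have : (g : C_c(X, ℝ)) x - (h : C_c(X, ℝ)) x ≤ (u : C_c(X, ℝ)) x := le_max_left _ _
    change 0 ≤ (h : C_c(X, ℝ)) x + (u : C_c(X, ℝ)) x + (-1) * (g : C_c(X, ℝ)) x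
    linarith
  rw [_root_.map_add, _root_.map_add, _root_.map_smul, smul_eq_mul, hfu] at hle
  have e1 := abs_le.1 ((hL.positive g hg).abs_sub_le hclose)
  have e2 := (hL.positive h hh).mono hfle
  rw [hL.apply_coe g hg] at e1
  rw [hL.apply_coe h hh] at e2
  linarith

lemma abs_sub_le (hL : RepresentsForm B L) (hB : IsPositiveLocal B)
    (hD : IsDenseSublattice D) {g k : D}
    (hg : ∀ x, 0 ≤ (g : C_c(X, ℝ)) x) (hk : ∀ x, 0 ≤ (k : C_c(X, ℝ)) x)
    {φ : C_c(X, ℝ)} (hφ : ∀ x, 0 ≤ φ x) {c ε : ℝ} (hc : 0 ≤ c) (hε : 0 ≤ ε)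
    (h : ∀ x, φ x ≠ 0 → |(g : C_c(X, ℝ)) x - c * (k : C_c(X, ℝ)) x| ≤ ε * (k : C_c(X, ℝ)) x) :
    |L g φ - c * L k φ| ≤ ε * L k φ := by
  have hck : ∀ x, 0 ≤ ((c • k : D) : C_c(X, ℝ)) x := fun x ↦ mul_nonneg hc (hk x)
  have hek : ∀ x, 0 ≤ ((ε • k : D) : C_c(X, ℝ)) x := fun x ↦ mul_nonneg hε (hk x)
  have e1 := hL.apply_le_apply hB hD hg (h := c • k + ε • k)
    (fun x ↦ add_nonneg (hck x) (hek x)) hφ fun x hx ↦ by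
      change _ ≤ c * (k : C_c(X, ℝ)) x + ε * (k : C_c(X, ℝ)) x
      linarith [abs_le.1 (h x hx)]
  have e2 := hL.apply_le_apply hB hD hck (h := g + ε • k)
    (fun x ↦ add_nonneg (hg x) (hek x)) hφ fun x hx ↦ by
      change c * (k : C_c(X, ℝ)) x ≤ (g : C_c(X, ℝ)) x + ε * (k : C_c(X, ℝ)) x
      linarith [abs_le.1 (h x hx)]
  rw [hL.map_add hD hck hek, hL.map_smul hD hk hc, hL.map_smul hD hk hε] at e1
  rw [hL.map_add hD hg hek, hL.map_smul hD hk hc, hL.map_smul hD hk hε] at e2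
  simp only [LinearMap.add_apply, LinearMap.smul_apply, smul_eq_mul] at e1 e2
  rw [abs_le]
  constructor <;> linarith

/-- Multiplying by `k` under `L g` is the same as multiplying by `g` under `L k`. -/
lemma apply_mul_comm_of_nonneg (hL : RepresentsForm B L) (hB : IsPositiveLocal B)
    (hD : IsDenseSublattice D) {g k : D}
    (hg : ∀ x, 0 ≤ (g : C_c(X, ℝ)) x) (hk : ∀ x, 0 ≤ (k : C_c(X, ℝ)) x)
    {φ : C_c(X, ℝ)} (hφ : ∀ x, 0 ≤ φ x) (hφk : ∀ x, φ x ≠ 0 → 1 ≤ (k : C_c(X, ℝ)) x) :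
    L g (φ * k) = L k (φ * g) := by
  let r : C(X, ℝ) := ⟨fun x ↦ (g : C_c(X, ℝ)) x / max ((k : C_c(X, ℝ)) x) 1,
    (map_continuous (g : C_c(X, ℝ))).div (by fun_prop)
      fun x ↦ (lt_max_of_lt_right one_pos).ne'⟩
  have hr0 : ∀ x, 0 ≤ r x := fun x ↦ div_nonneg (hg x) (le_max_of_le_right zero_le_one)
  have hrk : ∀ x, φ x ≠ 0 → (g : C_c(X, ℝ)) x = r x * (k : C_c(X, ℝ)) x := fun x hx ↦ by
    have h1 := hφk x hx
    change _ = (g : C_c(X, ℝ)) x / max ((k : C_c(X, ℝ)) x) 1 * (k : C_c(X, ℝ)) x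
    rw [max_eq_left h1, div_mul_cancel₀ _ (by positivity)]
  obtain ⟨M, -, hM⟩ := exists_forall_abs_le (g : C_c(X, ℝ))
  have hrM : ∀ x, r x ≤ M := fun x ↦
    (div_le_self (hg x) (le_max_right _ _)).trans ((le_abs_self _).trans (hM x))
  refine eq_of_abs_sub_nonpos (le_of_forall_pos_le_add_mul (c := 2 * L k (φ * k)) fun ε hε ↦ ?_)
  let P : ℕ → C(X, ℝ) := fun n ↦ ⟨fun x ↦ max 0 (min 1 (r x / ε - n + 1)), by fun_prop⟩
  have hP : ∀ n x, P n x = max 0 (min 1 (r x / ε - n + 1)) := fun n x ↦ rfl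
  obtain ⟨N, hN⟩ := exists_nat_ge (M / ε + 1)
  let ψ : ℕ → C_c(X, ℝ) := fun n ↦ (P n - P (n + 1)) • φ
  have hψ : ∀ n x, ψ n x = (P n x - P (n + 1) x) * φ x := fun n x ↦ rfl
  have hψ0 : ∀ n x, 0 ≤ ψ n x := fun n x ↦ by
    refine mul_nonneg (sub_nonneg.2 ?_) (hφ x)
    rw [hP, hP]
    gcongr
    simp
  have hsum : ∑ n ∈ Finset.range N, ψ n = φ := by
    ext x
    rw [CompactlySupportedContinuousMap.sum_apply]
    simp only [hψ]
    rw [← Finset.sum_mul, Finset.sum_range_sub' (fun n ↦ P n x)]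
    have h0 : P 0 x = 1 := by
      have : 0 ≤ r x / ε := div_nonneg (hr0 x) hε.le
      rw [hP, min_eq_left (by simpa using this)]
      simp
    have h1 : P N x = 0 := by
      have : r x / ε ≤ M / ε := by gcongr; exact hrM x
      rw [hP, max_eq_left]
      exact min_le_of_right_le (by linarith)
    rw [h0, h1, sub_zero, one_mul]
  have hnear : ∀ n x, ψ n x ≠ 0 → φ x ≠ 0 ∧ |r x - n * ε| ≤ ε := fun n x hx ↦ by
    refine ⟨right_ne_zero_of_mul hx, ?_⟩
    have hne : P n x - P (n + 1) x ≠ 0 := left_ne_zero_of_mul hx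
    rw [hP, hP] at hne
    push_cast at hne
    have hx : r x / ε * ε = r x := div_mul_cancel₀ _ hε.ne'
    have hlo : (n : ℝ) - 1 ≤ r x / ε := by
      by_contra! hlt
      apply hne
      rw [max_eq_left (min_le_of_right_le (by linarith)),
        max_eq_left (min_le_of_right_le (by linarith)), sub_zero]
    have hhi : r x / ε ≤ n + 1 := by
      by_contra! hlt
      apply hne
      rw [min_eq_left (by linarith), min_eq_left (by linarith), sub_self]
    rw [abs_le]
    constructor <;> nlinarith
  have hpiece : ∀ n, |L g (ψ n * k) - L k (ψ n * g)| ≤ ε * (2 * L k (ψ n * k)) := fun n ↦ by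
    have hgk : ∀ x, ψ n x ≠ 0 → |(g : C_c(X, ℝ)) x - (n * ε) * (k : C_c(X, ℝ)) x|
        ≤ ε * (k : C_c(X, ℝ)) x := fun x hx ↦ by
      obtain ⟨h1, h2⟩ := hnear n x hx
      rw [hrk x h1, ← sub_mul, abs_mul, abs_of_nonneg (hk x)]
      exact mul_le_mul_of_nonneg_right h2 (hk x)
    have e1 := hL.abs_sub_le hB hD hg hk (φ := ψ n * k) (fun x ↦ mul_nonneg (hψ0 n x) (hk x))
      (mul_nonneg n.cast_nonneg hε.le) hε.le fun x hx ↦ hgk x (left_ne_zero_of_mul hx)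
    have e2 := (hL.positive k hk).abs_sub_le (φ := ψ n * g) (ψ := (n * ε) • (ψ n * k))
      (η := ψ n * k) (ε := ε) fun x ↦ by
        change |ψ n x * (g : C_c(X, ℝ)) x - (n * ε) * (ψ n x * (k : C_c(X, ℝ)) x)|
          ≤ ε * (ψ n x * (k : C_c(X, ℝ)) x)
        by_cases hx : ψ n x = 0
        · simp [hx]
        · have hring : ψ n x * (g : C_c(X, ℝ)) x - (n * ε) * (ψ n x * (k : C_c(X, ℝ)) x) =
              ψ n x * ((g : C_c(X, ℝ)) x - (n * ε) * (k : C_c(X, ℝ)) x) := by ring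
          rw [hring, abs_mul, abs_of_nonneg (hψ0 n x), mul_left_comm ε]
          exact mul_le_mul_of_nonneg_left (hgk x hx) (hψ0 n x)
    rw [_root_.map_smul, smul_eq_mul] at e2
    have e1 := abs_le.1 e1
    have e2 := abs_le.1 e2
    rw [abs_le]
    constructor <;> linarith
  rw [zero_add, ← hsum]
  simp only [Finset.sum_mul, map_sum, ← Finset.sum_sub_distrib, Finset.mul_sum]
  exact (Finset.abs_sum_le_sum_abs _ _).trans (Finset.sum_le_sum fun n _ ↦ hpiece n)

end RepresentsForm

/-- `φ / k`, for functions `k` that are at least `1` on the support of `φ`. -/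
noncomputable def truncDiv (k : C_c(X, ℝ)) (φ : C_c(X, ℝ)) : C_c(X, ℝ) :=
  (⟨fun x ↦ (max (k x) 1)⁻¹, Continuous.inv₀ (by fun_prop)
    fun _ ↦ (lt_max_of_lt_right one_pos).ne'⟩ : C(X, ℝ)) • φ

lemma truncDiv_add (k φ ψ : C_c(X, ℝ)) : truncDiv k (φ + ψ) = truncDiv k φ + truncDiv k ψ := by
  ext x; exact mul_add _ _ _

lemma truncDiv_smul (k φ : C_c(X, ℝ)) (c : ℝ) : truncDiv k (c • φ) = c • truncDiv k φ := by
  ext x; exact mul_left_comm _ _ _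

lemma truncDiv_nonneg (k : C_c(X, ℝ)) {φ : C_c(X, ℝ)} (hφ : ∀ x, 0 ≤ φ x) (x : X) :
    0 ≤ truncDiv k φ x :=
  mul_nonneg (inv_nonneg.2 (le_max_of_le_right zero_le_one)) (hφ x)

lemma truncDiv_mul {k φ : C_c(X, ℝ)} (h : ∀ x, φ x ≠ 0 → 1 ≤ k x) : truncDiv k φ * k = φ := by
  ext x
  change (max (k x) 1)⁻¹ * φ x * k x = φ x
  by_cases hx : φ x = 0
  · simp [hx]
  · have := h x hx
    rw [max_eq_left this]
    field_simp

namespace RepresentsForm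

variable {D : Submodule ℝ C_c(X, ℝ)} {B : D →ₗ[ℝ] D →ₗ[ℝ] ℝ}
  {L : D → C_c(X, ℝ) →ₗ[ℝ] ℝ} [T2Space X] [LocallyCompactSpace X]

lemma apply_mul_comm (hL : RepresentsForm B L) (hB : IsPositiveLocal B)
    (hD : IsDenseSublattice D) {g k : D}
    (hg : ∀ x, 0 ≤ (g : C_c(X, ℝ)) x) (hk : ∀ x, 0 ≤ (k : C_c(X, ℝ)) x)
    {φ : C_c(X, ℝ)} (hφk : ∀ x, φ x ≠ 0 → 1 ≤ (k : C_c(X, ℝ)) x) :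
    L g (φ * k) = L k (φ * g) := by
  have hφ : φ = (φ ⊔ 0) - ((-φ) ⊔ 0) := by
    ext x
    rcases le_total (φ x) 0 with hx | hx <;> simp [hx]
  rw [hφ, sub_mul, sub_mul, map_sub, map_sub,
    hL.apply_mul_comm_of_nonneg hB hD hg hk (φ := φ ⊔ 0) (by simp) fun x hx ↦ hφk x ?_,
    hL.apply_mul_comm_of_nonneg hB hD hg hk (φ := (-φ) ⊔ 0) (by simp) fun x hx ↦ hφk x ?_]
  · rintro h; simp [h] at hx
  · rintro h; simp [h] at hx

lemma apply_truncDiv_eq (hL : RepresentsForm B L) (hB : IsPositiveLocal B)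
    (hD : IsDenseSublattice D) {k k' : D}
    (hk : ∀ x, 0 ≤ (k : C_c(X, ℝ)) x) (hk' : ∀ x, 0 ≤ (k' : C_c(X, ℝ)) x)
    {φ : C_c(X, ℝ)} (hφk : ∀ x, φ x ≠ 0 → 1 ≤ (k : C_c(X, ℝ)) x)
    (hφk' : ∀ x, φ x ≠ 0 → 1 ≤ (k' : C_c(X, ℝ)) x) :
    L k (truncDiv k φ) = L k' (truncDiv k' φ) := by
  have h := hL.apply_mul_comm hB hD hk hk' (φ := truncDiv k' (truncDiv k φ)) fun x hx ↦
    hφk' x (right_ne_zero_of_mul (right_ne_zero_of_mul hx))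
  rw [truncDiv_mul fun x hx ↦ hφk' x (right_ne_zero_of_mul hx)] at h
  rw [h]
  congr 1
  have hcomm : truncDiv (k' : C_c(X, ℝ)) (truncDiv k φ) = truncDiv k (truncDiv k' φ) := by
    ext x; exact mul_left_comm _ _ _
  rw [hcomm, truncDiv_mul fun x hx ↦ hφk x (right_ne_zero_of_mul hx)]

/-- The functional `Λ` with `Λ (f * g) = B f g`. -/
lemma exists_functional (hL : RepresentsForm B L) (hB : IsPositiveLocal B)
    (hD : IsDenseSublattice D) :
    ∃ Λ : C_c(X, ℝ) →ₗ[ℝ] ℝ, IsPositiveFunctional Λ ∧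
      ∀ f g : D, (∀ x, 0 ≤ (g : C_c(X, ℝ)) x) → Λ (f * g) = B f g := by
  choose κ hκD hκ0 hκ1 using fun φ : C_c(X, ℝ) ↦ hD.exists_one_le φ.hasCompactSupport
  have key : ∀ (φ : C_c(X, ℝ)) (k : D), (∀ x, 0 ≤ (k : C_c(X, ℝ)) x) →
      (∀ x, φ x ≠ 0 → 1 ≤ (k : C_c(X, ℝ)) x) →
      L ⟨κ φ, hκD φ⟩ (truncDiv (κ φ) φ) = L k (truncDiv k φ) := fun φ k hk hφk ↦
    hL.apply_truncDiv_eq hB hD (k := ⟨κ φ, hκD φ⟩) (hκ0 φ) hk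
      (fun x hx ↦ hκ1 φ x (subset_tsupport _ hx)) hφk
  refine ⟨⟨⟨fun φ ↦ L ⟨κ φ, hκD φ⟩ (truncDiv (κ φ) φ), fun φ ψ ↦ ?_⟩, fun c φ ↦ ?_⟩,
    fun φ hφ ↦ hL.positive _ (hκ0 φ) _ (truncDiv_nonneg _ hφ), fun f g hg ↦ ?_⟩
  · let k : D := ⟨κ φ + κ ψ, D.add_mem (hκD φ) (hκD ψ)⟩
    have hk : ∀ x, 0 ≤ (k : C_c(X, ℝ)) x := fun x ↦ add_nonneg (hκ0 φ x) (hκ0 ψ x)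
    have hφ : ∀ x, φ x ≠ 0 → 1 ≤ (k : C_c(X, ℝ)) x := fun x hx ↦
      le_add_of_le_of_nonneg (hκ1 φ x (subset_tsupport _ hx)) (hκ0 ψ x)
    have hψ : ∀ x, ψ x ≠ 0 → 1 ≤ (k : C_c(X, ℝ)) x := fun x hx ↦
      le_add_of_nonneg_of_le (hκ0 φ x) (hκ1 ψ x (subset_tsupport _ hx))
    rw [key φ k hk hφ, key ψ k hk hψ, key (φ + ψ) k hk, truncDiv_add, _root_.map_add]
    intro x hx
    by_cases h : φ x = 0
    · exact hψ x fun h' ↦ hx (by simp [h, h'])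
    · exact hφ x h
  · have hφ : ∀ x, φ x ≠ 0 → 1 ≤ κ φ x := fun x hx ↦ hκ1 φ x (subset_tsupport _ hx)
    change L ⟨κ (c • φ), hκD _⟩ (truncDiv (κ (c • φ)) (c • φ)) =
      c * L ⟨κ φ, hκD φ⟩ (truncDiv (κ φ) φ)
    rw [key (c • φ) ⟨κ φ, hκD φ⟩ (hκ0 φ) fun x hx ↦ hφ x (right_ne_zero_of_mul hx),
      truncDiv_smul, _root_.map_smul, smul_eq_mul]
  · change L ⟨κ (f * g), hκD _⟩ (truncDiv (κ (f * g)) (f * g)) = B f g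
    let k : D := ⟨κ f, hκD f⟩
    have hf : ∀ x, (f : C_c(X, ℝ)) x ≠ 0 → 1 ≤ (k : C_c(X, ℝ)) x := fun x hx ↦
      hκ1 f x (subset_tsupport _ hx)
    rw [key (f * g) k (hκ0 f) fun x hx ↦ hf x (left_ne_zero_of_mul hx)]
    have h := hL.apply_mul_comm hB hD hg (k := k) (hκ0 f) (φ := truncDiv k f) fun x hx ↦
      hf x (right_ne_zero_of_mul hx)
    rw [truncDiv_mul hf, hL.apply_coe g hg] at h
    rw [h]
    congr 1
    ext x
    exact (mul_assoc _ _ _).symm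

end RepresentsForm

lemma IsPositiveLocal.exists_functional {D : Submodule ℝ C_c(X, ℝ)} {B : D →ₗ[ℝ] D →ₗ[ℝ] ℝ}
    [T2Space X] [LocallyCompactSpace X] (hB : IsPositiveLocal B) (hD : IsDenseSublattice D) :
    ∃ Λ : C_c(X, ℝ) →ₗ[ℝ] ℝ, IsPositiveFunctional Λ ∧
      ∀ f g : D, (∀ x, 0 ≤ (g : C_c(X, ℝ)) x) → Λ (f * g) = B f g := by
  have h : ∀ g : D, ∃ L : C_c(X, ℝ) →ₗ[ℝ] ℝ, (∀ x, 0 ≤ (g : C_c(X, ℝ)) x) →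
      IsPositiveFunctional L ∧ ∀ f : D, L f = B f g := fun g ↦ by
    by_cases hg : ∀ x, 0 ≤ (g : C_c(X, ℝ)) x
    · obtain ⟨L, hL⟩ := hD.exists_extension (B.flip g) fun f hf ↦ hB.nonneg f g hf hg
      exact ⟨L, fun _ ↦ hL⟩
    · exact ⟨0, fun h ↦ absurd h hg⟩
  choose L hL using h
  exact RepresentsForm.exists_functional (L := L)
    ⟨fun g hg ↦ (hL g hg).1, fun g hg ↦ (hL g hg).2⟩ hB hD

/-- Positive functionals are determined by their values on squares from a dense sublattice. -/
lemma IsDenseSublattice.eq_of_forall_mul_self {D : Submodule ℝ C_c(X, ℝ)}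
    [T2Space X] [LocallyCompactSpace X] (hD : IsDenseSublattice D)
    {Λ₁ Λ₂ : C_c(X, ℝ) →ₗ[ℝ] ℝ} (h₁ : IsPositiveFunctional Λ₁) (h₂ : IsPositiveFunctional Λ₂)
    (h : ∀ f ∈ D, Λ₁ (f * f) = Λ₂ (f * f)) : Λ₁ = Λ₂ := by
  have hmul : ∀ f ∈ D, ∀ g ∈ D, Λ₁ (f * g) = Λ₂ (f * g) := fun f hf g hg ↦ by
    have hfg := h (f + g) (D.add_mem hf hg)
    have hsq : (f + g) * (f + g) = f * f + (2 : ℝ) • (f * g) + g * g := by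
      ext x
      change (f x + g x) * (f x + g x) = f x * f x + 2 * (f x * g x) + g x * g x
      ring
    simp only [hsq, map_add, map_smul, smul_eq_mul, h f hf, h g hg] at hfg
    linarith
  ext φ
  obtain ⟨g, hg, hg0, hg1⟩ := hD.exists_one_le φ.hasCompactSupport
  have := hD.eq_of_forall_mem (L₁ := Λ₁ ∘ₗ LinearMap.mulRight ℝ g)
    (L₂ := Λ₂ ∘ₗ LinearMap.mulRight ℝ g)
    (fun ψ hψ ↦ h₁ _ fun x ↦ mul_nonneg (hψ x) (hg0 x))
    (fun ψ hψ ↦ h₂ _ fun x ↦ mul_nonneg (hψ x) (hg0 x)) fun f hf ↦ hmul f hf g hg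
  have := LinearMap.congr_fun this (truncDiv g φ)
  simpa [truncDiv_mul fun x hx ↦ hg1 x (subset_tsupport _ hx)] using this

end DenseSublattice

/-- Let X be a locally compact metric space, D a dense linear
sublattice of C_c(X), and q a positive and local symmetric bilinear form on D
with q(f,f) ≥ 0. Then there is a unique Radon measure μ on X with
q(f,f) = ∫ f² dμ for all f ∈ D. -/
theorem positive_local_form_unique_measure
    {X : Type*} [MetricSpace X] [LocallyCompactSpace X]
    [MeasurableSpace X] [BorelSpace X]
    (D : Set (X → ℝ))
    (hD_cc : D ⊆ Cc X)
    (hD_zero : (0 : X → ℝ) ∈ D)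
    (hD_add : ∀ f ∈ D, ∀ g ∈ D, f + g ∈ D)
    (hD_smul : ∀ (c : ℝ), ∀ f ∈ D, c • f ∈ D)
    (hD_abs : ∀ f ∈ D, (fun x => |f x|) ∈ D)
    (hD_dense : ∀ g ∈ Cc X, ∀ ε > 0, ∃ f ∈ D, ∀ x, |f x - g x| < ε)
    (q : (X → ℝ) → (X → ℝ) → ℝ)
    (hq_symm : ∀ f ∈ D, ∀ g ∈ D, q f g = q g f)
    (hq_add : ∀ f ∈ D, ∀ g ∈ D, ∀ h ∈ D, q (f + g) h = q f h + q g h)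
    (hq_smul : ∀ (c : ℝ), ∀ f ∈ D, ∀ g ∈ D, q (c • f) g = c * q f g)
    (hq_nonneg : ∀ f ∈ D, 0 ≤ q f f)
    (hq_pos : ∀ f ∈ D, ∀ g ∈ D, (∀ x, 0 ≤ f x) → (∀ x, 0 ≤ g x) → 0 ≤ q f g)
    (hq_loc : ∀ f ∈ D, ∀ g ∈ D, (∀ x, f x * g x = 0) → q f g = 0) :
    ∃ μ : Measure X, (μ.Regular ∧ ∀ f ∈ D, q f f = ∫ x, (f x) ^ 2 ∂μ) ∧
      ∀ ν : Measure X, (ν.Regular ∧ ∀ f ∈ D, q f f = ∫ x, (f x) ^ 2 ∂ν) → ν = μ := by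
  let D' : Submodule ℝ C_c(X, ℝ) :=
    { carrier := {f | ⇑f ∈ D}
      add_mem' := fun {f g} hf hg ↦ hD_add f hf g hg
      zero_mem' := hD_zero
      smul_mem' := fun c f hf ↦ hD_smul c f hf }
  have lift : ∀ f ∈ D, ∃ F : D', ⇑(F : C_c(X, ℝ)) = f := fun f hf ↦
    ⟨⟨⟨⟨f, (hD_cc hf).1⟩, (hD_cc hf).2⟩, hf⟩, rfl⟩
  have hD : IsDenseSublattice D' := by
    refine ⟨fun f hf g hg ↦ ?_, fun φ ε hε ↦ ?_⟩
    · have h := hD_smul (1 / 2) _ (hD_add _ (hD_add _ hf _ hg) _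
        (hD_abs _ (hD_add _ hf _ (hD_smul (-1) _ hg))))
      change ⇑(f ⊔ g) ∈ D
      convert h using 1
      ext x
      simp only [CompactlySupportedContinuousMap.sup_apply, Pi.add_apply, Pi.smul_apply,
        smul_eq_mul]
      rw [max_def]
      split_ifs with hx
      · rw [abs_of_nonpos] <;> linarith
      · rw [abs_of_nonneg] <;> linarith
    · obtain ⟨f, hf, hfφ⟩ := hD_dense φ ⟨φ.continuous, φ.hasCompactSupport⟩ ε hε
      obtain ⟨F, rfl⟩ := lift f hf
      exact ⟨F, F.2, hfφ⟩
  let B : D' →ₗ[ℝ] D' →ₗ[ℝ] ℝ := LinearMap.mk₂ ℝ (fun f g ↦ q (f : C_c(X, ℝ)) (g : C_c(X, ℝ)))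
    (fun f g h ↦ hq_add _ f.2 _ g.2 _ h.2) (fun c f g ↦ hq_smul c _ f.2 _ g.2)
    (fun f g h ↦ by
      rw [hq_symm _ f.2 _ (g + h).2, hq_symm _ f.2 _ g.2, hq_symm _ f.2 _ h.2]
      exact hq_add _ g.2 _ h.2 _ f.2)
    (fun c f g ↦ by
      rw [hq_symm _ f.2 _ (c • g).2, hq_symm _ f.2 _ g.2]
      exact hq_smul c _ g.2 _ f.2)
  have hB : IsPositiveLocal B := ⟨fun f g ↦ hq_symm _ f.2 _ g.2,
    fun f g ↦ hq_pos _ f.2 _ g.2, fun f g ↦ hq_loc _ f.2 _ g.2⟩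
  obtain ⟨Λ, hΛ, hΛB⟩ := hB.exists_functional hD
  have hsq : ∀ f : D', Λ (f * f) = B f f := fun f ↦ by
    let F : D' := ⟨(f : C_c(X, ℝ)) ⊔ -f, hD.sup_mem _ f.2 _ (D'.neg_mem f.2)⟩
    have hF : ∀ x, (F : C_c(X, ℝ)) x = |(f : C_c(X, ℝ)) x| := fun x ↦ rfl
    have h1 := hΛB F F fun x ↦ by rw [hF]; positivity
    have h2 := hB.eq_zero (F + (-1 : ℝ) • f) (F + f) fun x ↦ by
      change ((F : C_c(X, ℝ)) x + (-1) * (f : C_c(X, ℝ)) x) *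
        ((F : C_c(X, ℝ)) x + (f : C_c(X, ℝ)) x) = 0
      rw [hF]
      nlinarith [abs_mul_abs_self ((f : C_c(X, ℝ)) x)]
    simp only [map_add, map_smul, LinearMap.add_apply, LinearMap.smul_apply, smul_eq_mul,
      hB.symm f F] at h2
    have h3 : (F : C_c(X, ℝ)) * F = f * f := by
      ext x
      exact abs_mul_abs_self _
    rw [h3] at h1
    linarith
  let Λ' : C_c(X, ℝ) →ₚ[ℝ] ℝ := PositiveLinearMap.mk₀ Λ fun φ hφ ↦ hΛ φ hφ
  refine ⟨RealRMK.rieszMeasure Λ', ⟨inferInstance, fun f hf ↦ ?_⟩, fun ν ⟨hν, hνq⟩ ↦ ?_⟩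
  · obtain ⟨F, rfl⟩ := lift f hf
    have h := RealRMK.integral_rieszMeasure Λ' (F * F)
    simp only [CompactlySupportedContinuousMap.mul_apply, ← sq] at h
    rw [h]
    exact (hsq F).symm
  · refine Measure.ext_of_integral_eq_on_compactlySupported fun φ ↦ ?_
    rw [RealRMK.integral_rieszMeasure]
    have hint : ∀ ψ : C_c(X, ℝ), Integrable ψ ν := fun ψ ↦ ψ.integrable
    let Λν : C_c(X, ℝ) →ₗ[ℝ] ℝ :=
      { toFun := fun ψ ↦ ∫ x, ψ x ∂ν
        map_add' := fun ψ η ↦ integral_add (hint ψ) (hint η)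
        map_smul' := fun c ψ ↦ integral_const_mul c ψ }
    have hΛν : Λν = Λ := hD.eq_of_forall_mul_self (fun ψ hψ ↦ integral_nonneg hψ) hΛ
      fun f hf ↦ by
        rw [hsq ⟨f, hf⟩]
        refine Eq.trans ?_ (hνq f hf).symm
        simp only [sq]
        rfl
    exact LinearMap.congr_fun hΛν φ
end

section
/- Let Y be a set and let D be a linear subspace of the space of real-valued functions on Y that is closed under taking pointwise absolute value. Let q be a symmetric bilinear form on D with q(f,f) ≥ 0 for all f ∈ D, which is positive (q(f,g) ≥ 0 whenever f, g ∈ D are nonnegative pointwise) and local (q(f,g) = 0 whenever f, g ∈ D satisfy f·g = 0 pointwise). Then q is monotone: for all f, g ∈ D with |f| ≤ |g| pointwise, q(f,f) ≤ q(g,g). -/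
/-- Let Y be a set and D a linear subspace of the real-valued
functions on Y closed under pointwise absolute value. If q is a symmetric
bilinear form on D with q(f,f) ≥ 0 that is positive and local, then q is
monotone: |f| ≤ |g| pointwise implies q(f,f) ≤ q(g,g). -/
theorem positive_local_implies_monotone_functions
    {Y : Type*}
    (D : Set (Y → ℝ))
    (hD_zero : (0 : Y → ℝ) ∈ D)
    (hD_add : ∀ f ∈ D, ∀ g ∈ D, f + g ∈ D)
    (hD_smul : ∀ (c : ℝ), ∀ f ∈ D, c • f ∈ D)
    (hD_abs : ∀ f ∈ D, (fun y => |f y|) ∈ D)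
    (q : (Y → ℝ) → (Y → ℝ) → ℝ)
    (hq_symm : ∀ f ∈ D, ∀ g ∈ D, q f g = q g f)
    (hq_add : ∀ f ∈ D, ∀ g ∈ D, ∀ h ∈ D, q (f + g) h = q f h + q g h)
    (hq_smul : ∀ (c : ℝ), ∀ f ∈ D, ∀ g ∈ D, q (c • f) g = c * q f g)
    (hq_nonneg : ∀ f ∈ D, 0 ≤ q f f)
    (hq_pos : ∀ f ∈ D, ∀ g ∈ D, (∀ y, 0 ≤ f y) → (∀ y, 0 ≤ g y) → 0 ≤ q f g)
    (hq_loc : ∀ f ∈ D, ∀ g ∈ D, (∀ y, f y * g y = 0) → q f g = 0) :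
    ∀ f ∈ D, ∀ g ∈ D, (∀ y, |f y| ≤ |g y|) → q f f ≤ q g g := by
  have hneg : ∀ v ∈ D, (-1 : ℝ) • v ∈ D := hD_smul (-1)
  have key : ∀ u ∈ D, ∀ v ∈ D, q (u + v) (u + (-1 : ℝ) • v) = q u u - q v v := by
    intro u hu v hv
    have hw := hD_add u hu _ (hneg v hv)
    rw [hq_add u hu v hv _ hw, hq_symm u hu _ hw, hq_symm v hv _ hw,
      hq_add u hu _ (hneg v hv) u hu, hq_add u hu _ (hneg v hv) v hv,
      hq_smul _ v hv u hu, hq_smul _ v hv v hv, hq_symm u hu v hv]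
    ring
  have habs : ∀ f ∈ D, q (fun y => |f y|) (fun y => |f y|) = q f f := by
    intro f hf
    have ha := hD_abs f hf
    have h0 := hq_loc _ (hD_add _ ha f hf) _ (hD_add _ ha _ (hneg f hf)) fun y => by
      simp only [Pi.add_apply, Pi.smul_apply, smul_eq_mul]
      linear_combination abs_mul_abs_self (f y)
    rw [key _ ha f hf] at h0
    exact sub_eq_zero.mp h0
  intro f hf g hg hfg
  have hf' := hD_abs f hf
  have hg' := hD_abs g hg
  have h := hq_pos _ (hD_add _ hg' _ hf') _ (hD_add _ hg' _ (hneg _ hf'))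
    (fun y => add_nonneg (abs_nonneg _) (abs_nonneg _))
    (fun y => by
      simp only [Pi.add_apply, Pi.smul_apply, smul_eq_mul]
      linarith [hfg y])
  rw [key _ hg' _ hf', habs f hf, habs g hg] at h
  exact sub_nonneg.mp h
end

section
/- Let n ≥ 1, let Ω ⊆ ℝⁿ be open, let s ∈ (0,1), and set K(x,y) = |x−y|^{−(n+2s)} for x ≠ y. Let f, φ : Ω → ℝ be measurable with f bounded and 0 ≤ φ ≤ 1 pointwise. Assume that ∬_{Ω×Ω} (φ(x)−φ(y))² K(x,y) dx dy < ∞ and ∬_{Ω×Ω} (φ(x)f(x)−φ(y)f(y))² K(x,y) dx dy < ∞. Then the function (x,y) ↦ (φ(x)f(x)²−φ(y)f(y)²)(φ(x)−φ(y)) K(x,y) is integrable on Ω×Ω and ½ ∬_{Ω×Ω} (φ(x)f(x)−φ(y)f(y))² K(x,y) dx dy − ½ ∬_{Ω×Ω} (φ(x)f(x)²−φ(y)f(y)²)(φ(x)−φ(y)) K(x,y) dx dy = ½ ∬_{Ω×Ω} φ(x)φ(y) (f(x)−f(y))² K(x,y) dx dy. -/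
open MeasureTheory

/-- Writing `u = a * F - b * G` and `v = a - b`, one has
`a * F ^ 2 - b * G ^ 2 = (F + G) * u - F * G * v`, so that its product with `v` is controlled by
`u ^ 2` and `v ^ 2` when `F` and `G` are bounded. -/
theorem abs_form_le {F G C : ℝ} (hF : |F| ≤ C) (hG : |G| ≤ C) (a b : ℝ) :
    |(a * F ^ 2 - b * G ^ 2) * (a - b)| ≤
      C * (a * F - b * G) ^ 2 + (C + C ^ 2) * (a - b) ^ 2 := by
  have hC : 0 ≤ C := (abs_nonneg F).trans hF
  have hsum : |F + G| ≤ 2 * C := (abs_add_le F G).trans (by linarith)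
  have hprod : |F * G| ≤ C ^ 2 := by
    rw [abs_mul, sq]
    exact mul_le_mul hF hG (abs_nonneg G) hC
  have hamgm : 2 * |(a * F - b * G) * (a - b)| ≤ (a * F - b * G) ^ 2 + (a - b) ^ 2 := by
    rw [abs_mul, ← sq_abs (a * F - b * G), ← sq_abs (a - b), ← mul_assoc]
    exact two_mul_le_add_sq _ _
  calc |(a * F ^ 2 - b * G ^ 2) * (a - b)|
      = |(F + G) * ((a * F - b * G) * (a - b)) - F * G * (a - b) ^ 2| := by
        congr 1
        ring
    _ ≤ |F + G| * |(a * F - b * G) * (a - b)| + |F * G| * (a - b) ^ 2 := by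
        refine (abs_sub _ _).trans_eq ?_
        rw [abs_mul (F + G), abs_mul (F * G), abs_of_nonneg (sq_nonneg (a - b))]
    _ ≤ 2 * C * |(a * F - b * G) * (a - b)| + C ^ 2 * (a - b) ^ 2 := by gcongr
    _ ≤ C * (a * F - b * G) ^ 2 + (C + C ^ 2) * (a - b) ^ 2 := by
        linarith [mul_le_mul_of_nonneg_left hamgm hC]

/-- Let Ω ⊆ ℝⁿ be open, 0 < s < 1, and K(x,y) = |x−y|^{−(n+2s)}.
Let f, φ : Ω → ℝ be measurable with f bounded and 0 ≤ φ ≤ 1. If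
∬ (φ(x)−φ(y))² K < ∞ and ∬ (φ(x)f(x)−φ(y)f(y))² K < ∞, then
(φ(x)f(x)²−φ(y)f(y)²)(φ(x)−φ(y)) K is integrable on Ω×Ω and
½∬ (φ(x)f(x)−φ(y)f(y))² K − ½∬ (φ(x)f(x)²−φ(y)f(y)²)(φ(x)−φ(y)) K
  = ½∬ φ(x)φ(y)(f(x)−f(y))² K. -/
theorem fractional_form_identity
    (n : ℕ) (hn : 1 ≤ n)
    (Ω : Set (EuclideanSpace ℝ (Fin n))) (hΩ : IsOpen Ω)
    (s : ℝ) (hs0 : 0 < s) (hs1 : s < 1)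
    (f φ : EuclideanSpace ℝ (Fin n) → ℝ)
    (hf_meas : AEMeasurable f (volume.restrict Ω))
    (hφ_meas : AEMeasurable φ (volume.restrict Ω))
    (hf_bdd : ∃ C : ℝ, ∀ x ∈ Ω, |f x| ≤ C)
    (hφ0 : ∀ x ∈ Ω, 0 ≤ φ x) (hφ1 : ∀ x ∈ Ω, φ x ≤ 1)
    (hint_φ : IntegrableOn
      (fun p : EuclideanSpace ℝ (Fin n) × EuclideanSpace ℝ (Fin n) =>
        (φ p.1 - φ p.2) ^ 2 * ‖p.1 - p.2‖ ^ (-((n : ℝ) + 2 * s))) (Ω ×ˢ Ω))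
    (hint_φf : IntegrableOn
      (fun p : EuclideanSpace ℝ (Fin n) × EuclideanSpace ℝ (Fin n) =>
        (φ p.1 * f p.1 - φ p.2 * f p.2) ^ 2 * ‖p.1 - p.2‖ ^ (-((n : ℝ) + 2 * s)))
      (Ω ×ˢ Ω)) :
    IntegrableOn
      (fun p : EuclideanSpace ℝ (Fin n) × EuclideanSpace ℝ (Fin n) =>
        (φ p.1 * (f p.1) ^ 2 - φ p.2 * (f p.2) ^ 2) * (φ p.1 - φ p.2) *
          ‖p.1 - p.2‖ ^ (-((n : ℝ) + 2 * s))) (Ω ×ˢ Ω) ∧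
    (1 / 2) * (∫ p in Ω ×ˢ Ω,
        (φ p.1 * f p.1 - φ p.2 * f p.2) ^ 2 * ‖p.1 - p.2‖ ^ (-((n : ℝ) + 2 * s)))
      - (1 / 2) * (∫ p in Ω ×ˢ Ω,
        (φ p.1 * (f p.1) ^ 2 - φ p.2 * (f p.2) ^ 2) * (φ p.1 - φ p.2) *
          ‖p.1 - p.2‖ ^ (-((n : ℝ) + 2 * s)))
      = (1 / 2) * (∫ p in Ω ×ˢ Ω,
        φ p.1 * φ p.2 * (f p.1 - f p.2) ^ 2 * ‖p.1 - p.2‖ ^ (-((n : ℝ) + 2 * s))) := by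
  have hvol : (volume : Measure (EuclideanSpace ℝ (Fin n) × EuclideanSpace ℝ (Fin n))).restrict
      (Ω ×ˢ Ω) = (volume.restrict Ω).prod (volume.restrict Ω) := by
    rw [Measure.prod_restrict, Measure.volume_eq_prod]
  have hint : IntegrableOn
      (fun p : EuclideanSpace ℝ (Fin n) × EuclideanSpace ℝ (Fin n) =>
        (φ p.1 * (f p.1) ^ 2 - φ p.2 * (f p.2) ^ 2) * (φ p.1 - φ p.2) *
          ‖p.1 - p.2‖ ^ (-((n : ℝ) + 2 * s))) (Ω ×ˢ Ω) := by
    obtain ⟨C, hC⟩ := hf_bdd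
    refine Integrable.mono' ((hint_φf.const_mul C).add (hint_φ.const_mul (C + C ^ 2))) ?_ ?_
    · rw [hvol]
      have hf₁ := hf_meas.comp_fst (ν := volume.restrict Ω)
      have hf₂ := hf_meas.comp_snd (μ := volume.restrict Ω)
      have hφ₁ := hφ_meas.comp_fst (ν := volume.restrict Ω)
      have hφ₂ := hφ_meas.comp_snd (μ := volume.restrict Ω)
      have hK : Measurable (fun p : EuclideanSpace ℝ (Fin n) × EuclideanSpace ℝ (Fin n) =>
          ‖p.1 - p.2‖ ^ (-((n : ℝ) + 2 * s))) := by fun_prop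
      exact ((((hφ₁.mul (hf₁.pow_const 2)).sub (hφ₂.mul (hf₂.pow_const 2))).mul
        (hφ₁.sub hφ₂)).mul hK.aemeasurable).aestronglyMeasurable
    · refine (ae_restrict_iff' (hΩ.measurableSet.prod hΩ.measurableSet)).2 (.of_forall ?_)
      rintro ⟨x, y⟩ ⟨hx, hy⟩
      have hK : 0 ≤ ‖x - y‖ ^ (-((n : ℝ) + 2 * s)) := by positivity
      rw [Real.norm_eq_abs, abs_mul, abs_of_nonneg hK]
      refine (mul_le_mul_of_nonneg_right
        (abs_form_le (hC x hx) (hC y hy) (φ x) (φ y)) hK).trans_eq ?_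
      simp only [Pi.add_apply]
      ring
  refine ⟨hint, ?_⟩
  rw [← mul_sub, ← integral_sub hint_φf hint]
  congr 2
  ext p
  ring
end
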